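/- Let W be a 2-dimensional complex vector space, Z : 𝒦(W) → 𝒦(W*) a continuous, translation invariant, SL(W,ℂ)-contravariant Minkowski valuation, f_2 its McMullen component of degree 2, and let E ⊂ W be a 3-dimensional real subspace of the form E = span_ℝ{e_1, ie_1, e_2} with e_1, e_2 linearly independent over ℂ. Then there exists a continuous, positively 1-homogeneous, odd function φ_u : E* → ℝ for each u ∈ W, unique up to adding a linear function, such that f_2(K, u) = V(K, K, φ_u) for all convex bodies K ⊂ E, where V(K,K,·) denotes the mixed-volume functional on 1-homogeneous continuous functions on E*. -/

import Mathlib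

open scoped Pointwise
open MeasureTheory Module

noncomputable section

section CommonDefs

variable {V V' A : Type*}
variable [NormedAddCommGroup V] [NormedSpace ℝ V]
variable [NormedAddCommGroup V'] [NormedSpace ℝ V']
variable [NormedAddCommGroup A] [NormedSpace ℝ A]

/-- The supremum of a (pairing) functional over a convex body; used to express the
support function `h(K, ξ) = sup_{x ∈ K} ⟨ξ, x⟩` for the various pairings `p = ⟨ξ, ·⟩`. -/
def hSupp (K : ConvexBody V) (p : V → ℝ) : ℝ := sSup (p '' (K : Set V))

/-- The translate `x + K` of a convex body. -/
def ConvexBody.translate (K : ConvexBody V) (x : V) : ConvexBody V :=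
  ⟨(fun y => x + y) '' (K : Set V), K.convex.translate x,
    K.isCompact.image (continuous_const.add continuous_id),
    K.nonempty.image _⟩

/-- The image of a convex body under a continuous linear map. -/
def ConvexBody.mapCLM (f : V →L[ℝ] V') (K : ConvexBody V) : ConvexBody V' :=
  ⟨f '' (K : Set V), K.convex.linear_image (f : V →ₗ[ℝ] V'),
    K.isCompact.image f.continuous, K.nonempty.image _⟩

/-- The reflection `-K` of a convex body about the origin. -/
def ConvexBody.neg (K : ConvexBody V) : ConvexBody V :=
  K.mapCLM (-(ContinuousLinearMap.id ℝ V))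

/-- The union of two convex bodies (a convex body provided it is convex). -/
def ConvexBody.union (K L : ConvexBody V) (h : Convex ℝ ((K : Set V) ∪ (L : Set V))) :
    ConvexBody V :=
  ⟨(K : Set V) ∪ (L : Set V), h, K.isCompact.union L.isCompact,
    K.nonempty.mono Set.subset_union_left⟩

/-- The intersection of two convex bodies (a convex body provided it is nonempty). -/
def ConvexBody.inter (K L : ConvexBody V) (h : ((K : Set V) ∩ (L : Set V)).Nonempty) :
    ConvexBody V :=
  ⟨(K : Set V) ∩ (L : Set V), K.convex.inter L.convex,
    K.isCompact.inter_right L.isClosed, h⟩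

/-- A Minkowski valuation: `Z(K ∪ L) + Z(K ∩ L) = Z(K) + Z(L)` (Minkowski addition)
whenever `K, L, K ∪ L` are convex bodies. -/
def IsMinkowskiValuation (Z : ConvexBody V → ConvexBody A) : Prop :=
  ∀ (K L : ConvexBody V) (hU : Convex ℝ ((K : Set V) ∪ (L : Set V)))
    (hI : ((K : Set V) ∩ (L : Set V)).Nonempty),
    Z (K.union L hU) + Z (K.inter L hI) = Z K + Z L

/-- A real-valued valuation: `φ(K ∪ L) + φ(K ∩ L) = φ(K) + φ(L)`
whenever `K, L, K ∪ L` are convex bodies. -/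
def IsValuation (φ : ConvexBody V → ℝ) : Prop :=
  ∀ (K L : ConvexBody V) (hU : Convex ℝ ((K : Set V) ∪ (L : Set V)))
    (hI : ((K : Set V) ∩ (L : Set V)).Nonempty),
    φ (K.union L hU) + φ (K.inter L hI) = φ K + φ L

/-- Translation invariance of a map defined on convex bodies. -/
def IsTranslationInvariant {α : Type*} (Z : ConvexBody V → α) : Prop :=
  ∀ (K : ConvexBody V) (x : V), Z (K.translate x) = Z K

/-- The mixed volume (w.r.t. the Lebesgue (Haar) measure `μ`) of an `n`-tuple of convex
bodies, given by the polarization formula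
`V(K₁, …, Kₙ) = (1/n!) ∑_{S ⊆ {1,…,n}} (-1)^{n - |S|} vol(∑_{i ∈ S} K_i)`. -/
def mixedVol [MeasurableSpace V] (μ : Measure V) {n : ℕ} (K : Fin n → ConvexBody V) : ℝ :=
  (n.factorial : ℝ)⁻¹ *
    ∑ S : Finset (Fin n), (-1 : ℝ) ^ (n - S.card) * (μ (∑ i ∈ S, (K i : Set V))).toReal

/-- The extension `V(K, …, K, f)` (with `n - 1` copies of `K`) of the mixed volume to
continuous positively `1`-homogeneous functions `f` on the dual space, defined via
Aleksandrov's variational formula: `V(K,…,K,f)` is `1/n` times the right derivative at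
`t = 0` of the volume of the Wulff shape (aka Aleksandrov body) of `h_K + t f`.
For `f = h_L` the Wulff shape is `K + t L`, so this indeed extends `L ↦ V(K, …, K, L)`. -/
def mixedVolFn [MeasurableSpace V] (μ : Measure V) (K : ConvexBody V)
    (f : (V →L[ℝ] ℝ) → ℝ) : ℝ :=
  (Module.finrank ℝ V : ℝ)⁻¹ *
    derivWithin (fun t : ℝ =>
        (μ {x : V | ∀ ξ : V →L[ℝ] ℝ, ξ x ≤ hSupp K ξ + t * f ξ}).toReal)
      (Set.Ici 0) 0

/-- The dimension of a convex body: the dimension of (the direction of) its affine hull. -/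
def bodyDim (K : ConvexBody V) : ℕ := Module.finrank ℝ (vectorSpan ℝ (K : Set V))

/-- A convex body contained in a subspace `E`, viewed as a convex body of `E`. -/
def bodyIn (E : Submodule ℝ V) (K : ConvexBody V) (h : (K : Set V) ⊆ (E : Set V)) :
    ConvexBody ↥E :=
  ⟨Subtype.val ⁻¹' (K : Set V),
    K.convex.linear_preimage (E.subtype),
    by
      rw [Topology.IsEmbedding.subtypeVal.isCompact_iff,
        Set.image_preimage_eq_of_subset (by rw [Subtype.range_coe]; exact h)]
      exact K.isCompact,
    by obtain ⟨x, hx⟩ := K.nonempty; exact ⟨⟨x, h hx⟩, hx⟩⟩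

/-- The properties of the components of McMullen's decomposition of (the support function
of) a Minkowski valuation: each `fᵢ(·, u)` is a continuous, translation invariant
valuation, homogeneous of degree `i`, and each `fᵢ(K, ·)` is continuous and positively
`1`-homogeneous. -/
def McMullenProps (f : ℕ → ConvexBody V → V → ℝ) : Prop :=
  (∀ (i : ℕ) (u : V), Continuous fun K : ConvexBody V => f i K u) ∧
  (∀ (i : ℕ) (u : V), IsValuation fun K : ConvexBody V => f i K u) ∧
  (∀ (i : ℕ) (u : V), IsTranslationInvariant fun K : ConvexBody V => f i K u) ∧
  (∀ (i : ℕ) (K : ConvexBody V) (u : V) (t : ℝ), 0 < t → f i (t • K) u = t ^ i * f i K u) ∧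
  (∀ (i : ℕ) (K : ConvexBody V), Continuous fun u : V => f i K u) ∧
  (∀ (i : ℕ) (K : ConvexBody V) (u : V) (t : ℝ), 0 < t → f i K (t • u) = t * f i K u)

end CommonDefs

/-- The surface area measure `S(M, ·)` on `S¹ ⊆ ℂ` of a planar convex body `M`,
characterized (uniquely) by the property that it is a finite measure concentrated on the
unit circle with `∫_{S¹} h(L, α) dσ(α) = 2 V(M, L)` for every planar convex body `L`. -/
def IsSurfaceAreaMeasure (M : ConvexBody ℂ) (σ : Measure ℂ) : Prop :=
  IsFiniteMeasure σ ∧ σ (Metric.sphere (0 : ℂ) 1)ᶜ = 0 ∧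
    ∀ L : ConvexBody ℂ,
      (∫ α, hSupp L (fun c => (c * (starRingEnd ℂ) α).re) ∂σ) = 2 * mixedVol volume ![M, L]

section ComplexDefs

variable {W : Type*} [NormedAddCommGroup W] [NormedSpace ℂ W] [FiniteDimensional ℂ W]

/-- The determinant pairing `det(u, v)` on a 2-dimensional complex vector space,
with respect to a fixed basis `b`. -/
def cdet (b : Basis (Fin 2) ℂ W) (u v : W) : ℂ :=
  b.coord 0 u * b.coord 1 v - b.coord 1 u * b.coord 0 v

/-- `det(·, w) : W → ℂ` as a continuous real-linear map. -/
def cdetCLM (b : Basis (Fin 2) ℂ W) (w : W) : W →L[ℝ] ℂ :=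
  LinearMap.toContinuousLinearMap
    (((b.coord 1 w) • (b.coord 0 : W →ₗ[ℂ] ℂ)
      - (b.coord 0 w) • (b.coord 1 : W →ₗ[ℂ] ℂ)).restrictScalars ℝ)

/-- `det(K, w) = {det(k, w) : k ∈ K} ⊆ ℂ`. -/
def detBody (b : Basis (Fin 2) ℂ W) (K : ConvexBody W) (w : W) : ConvexBody ℂ :=
  K.mapCLM (cdetCLM b w)

/-- `N · w = {c • w : c ∈ N} ⊆ W` for a planar convex body `N ⊆ ℂ`. -/
def dotBody (N : ConvexBody ℂ) (w : W) : ConvexBody W :=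
  N.mapCLM (LinearMap.toContinuousLinearMap ((LinearMap.toSpanSingleton ℂ W w).restrictScalars ℝ))

/-- A complex-linear endomorphism, as a continuous real-linear map. -/
def cReal (g : W →ₗ[ℂ] W) : W →L[ℝ] W :=
  LinearMap.toContinuousLinearMap (g.restrictScalars ℝ)

/-- Precomposition `ξ ↦ ξ ∘ g` on the complex dual `W* = W →L[ℂ] ℂ`,
as a continuous real-linear map. The adjoint of `g` is `precompDual g`, and
`g^{-*} = precompDual g⁻¹`. -/
def precompDual (g : W →L[ℂ] W) : (W →L[ℂ] ℂ) →L[ℝ] (W →L[ℂ] ℂ) :=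
  LinearMap.toContinuousLinearMap
    { toFun := fun ξ => ξ.comp g
      map_add' := fun ξ η => ContinuousLinearMap.add_comp ξ η g
      map_smul' := fun r ξ => ContinuousLinearMap.smul_comp r ξ g }

/-- `Z : 𝒦(W) → 𝒦(W*)` is `SL(W,ℂ)`-contravariant: `Z(gK) = g^{-*} Z(K)` for every
`g ∈ SL(W,ℂ)`. -/
def IsSLContravariant (Z : ConvexBody W → ConvexBody (W →L[ℂ] ℂ)) : Prop :=
  ∀ g : W ≃L[ℂ] W, LinearMap.det ((g : W →L[ℂ] W) : W →ₗ[ℂ] W) = 1 →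
    ∀ K : ConvexBody W,
      Z (K.mapCLM (cReal (g : W →ₗ[ℂ] W))) =
        (Z K).mapCLM (precompDual (g.symm : W →L[ℂ] W))

/-- `Z : 𝒦(W) → 𝒦(W)` is `SL(W,ℂ)`-covariant: `Z(gK) = g Z(K)` for every
`g ∈ SL(W,ℂ)`. -/
def IsSLCovariant (Z : ConvexBody W → ConvexBody W) : Prop :=
  ∀ g : W ≃L[ℂ] W, LinearMap.det ((g : W →L[ℂ] W) : W →ₗ[ℂ] W) = 1 →
    ∀ K : ConvexBody W,
      Z (K.mapCLM (cReal (g : W →ₗ[ℂ] W))) = (Z K).mapCLM (cReal (g : W →ₗ[ℂ] W))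

end ComplexDefs

section Dissection

variable {V : Type*} [NormedAddCommGroup V] [NormedSpace ℝ V]

open Classical in
/-- The extension by zero of a functional on convex bodies to arbitrary sets. -/
def extendByZero (μ : ConvexBody V → ℝ) (S : Set V) : ℝ :=
  if h : Convex ℝ S ∧ IsCompact S ∧ S.Nonempty then μ ⟨S, h.1, h.2.1, h.2.2⟩ else 0

theorem extendByZero_coe (μ : ConvexBody V → ℝ) (K : ConvexBody V) :
    extendByZero μ (K : Set V) = μ K := by
  unfold extendByZero
  rw [dif_pos ⟨K.convex, K.isCompact, K.nonempty⟩]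
  rfl

theorem extendByZero_eq (μ : ConvexBody V → ℝ) {S : Set V} (K : ConvexBody V)
    (h : S = (K : Set V)) : extendByZero μ S = μ K := by
  rw [h, extendByZero_coe]

theorem extendByZero_of_forall (μ : ConvexBody V → ℝ) {S : Set V}
    (h : ∀ K : ConvexBody V, (K : Set V) = S → μ K = 0) : extendByZero μ S = 0 := by
  unfold extendByZero
  split_ifs with hS
  · exact h _ rfl
  · rfl

theorem extendByZero_union {μ : ConvexBody V → ℝ} (hμ : IsValuation μ) {A B : Set V}
    (hA : Convex ℝ A) (hA' : IsCompact A) (hB : Convex ℝ B) (hB' : IsCompact B)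
    (hAB : Convex ℝ (A ∪ B)) (h0 : extendByZero μ (A ∩ B) = 0) :
    extendByZero μ (A ∪ B) = extendByZero μ A + extendByZero μ B := by
  have hempty : extendByZero μ ∅ = 0 := by simp [extendByZero]
  rcases A.eq_empty_or_nonempty with rfl | hAn
  · simp [hempty]
  rcases B.eq_empty_or_nonempty with rfl | hBn
  · simp [hempty]
  have hI : (A ∩ B).Nonempty := by
    have := isPreconnected_closed_iff.1 hAB.isPreconnected A B hA'.isClosed hB'.isClosed
      subset_rfl (hAn.mono fun x hx => ⟨Or.inl hx, hx⟩) (hBn.mono fun x hx => ⟨Or.inr hx, hx⟩)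
    exact this.mono fun x hx => hx.2
  have key := hμ ⟨A, hA, hA', hAn⟩ ⟨B, hB, hB', hBn⟩ hAB hI
  have h1 : extendByZero μ (A ∩ B) = _ :=
    extendByZero_eq μ (ConvexBody.inter ⟨A, hA, hA', hAn⟩ ⟨B, hB, hB', hBn⟩ hI) rfl
  have h2 : extendByZero μ (A ∪ B) = _ :=
    extendByZero_eq μ (ConvexBody.union ⟨A, hA, hA', hAn⟩ ⟨B, hB, hB', hBn⟩ hAB) rfl
  have h3 : extendByZero μ A = _ := extendByZero_eq μ ⟨A, hA, hA', hAn⟩ rfl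
  have h4 : extendByZero μ B = _ := extendByZero_eq μ ⟨B, hB, hB', hBn⟩ rfl
  rw [h0] at h1
  rw [h2, h3, h4]
  linarith

/-- `μ` vanishes on all convex bodies of `F` contained in an affine hyperplane of `F`. -/
def IsSimpleOn (μ : ConvexBody V → ℝ) (F : Submodule ℝ V) : Prop :=
  ∀ K : ConvexBody V, (K : Set V) ⊆ F → ∀ (l : V →L[ℝ] ℝ) (c : ℝ), (∃ x ∈ F, l x ≠ 0) →
    (∀ x ∈ K, l x = c) → μ K = 0

theorem IsSimpleOn.extendByZero {μ : ConvexBody V → ℝ} {F : Submodule ℝ V}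
    (h : IsSimpleOn μ F) {S : Set V} (hS : S ⊆ F) (l : V →L[ℝ] ℝ) (c : ℝ)
    (hl : ∃ x ∈ F, l x ≠ 0) (hc : ∀ x ∈ S, l x = c) : extendByZero μ S = 0 :=
  extendByZero_of_forall μ fun K hK => h K (hK ▸ hS) l c hl fun x hx => hc x (hK ▸ hx)

theorem exists_functional_const_on [FiniteDimensional ℝ V] {F : Submodule ℝ V} {R : Set V}
    (hR : R ⊆ F) (hfin : R.Finite) (hpos : 0 < finrank ℝ F) (hcard : R.ncard ≤ finrank ℝ F) :
    ∃ (l : V →L[ℝ] ℝ) (c : ℝ), (∃ x ∈ F, l x ≠ 0) ∧ ∀ x ∈ R, l x = c := by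
  classical
  have main : ∀ G : Submodule ℝ V, G ≤ F → finrank ℝ G < finrank ℝ F →
      ∃ l : V →L[ℝ] ℝ, (∃ x ∈ F, l x ≠ 0) ∧ ∀ x ∈ G, l x = 0 := by
    intro G hG hlt
    have hne : ∃ x ∈ F, x ∉ G := by
      by_contra! h
      have : F ≤ G := h
      exact absurd (Submodule.finrank_mono this) (not_le.2 hlt)
    obtain ⟨x, hx, hxG⟩ := hne
    obtain ⟨l, hlx, hl⟩ := Submodule.exists_le_ker_of_notMem hxG
    exact ⟨LinearMap.toContinuousLinearMap l, ⟨x, hx, hlx⟩, fun y hy => hl hy⟩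
  rcases R.eq_empty_or_nonempty with rfl | ⟨r, hr⟩
  · obtain ⟨l, hl, -⟩ := main ⊥ bot_le (by simpa using hpos)
    exact ⟨l, 0, hl, by simp⟩
  · set D : Set V := (fun x => x - r) '' (R \ {r}) with hD
    have hDfin : D.Finite := (hfin.subset Set.sdiff_subset).image _
    have hDcard : D.ncard < finrank ℝ F := by
      have h1 : D.ncard ≤ (R \ {r}).ncard := Set.ncard_image_le (hfin.subset Set.sdiff_subset)
      have h2 := Set.ncard_sdiff_singleton_lt_of_mem hr hfin
      omega
    have hspan : finrank ℝ (Submodule.span ℝ D) ≤ D.ncard := by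
      have := hDfin.fintype
      rw [Set.ncard_eq_toFinset_card' D]
      exact finrank_span_le_card D
    obtain ⟨l, hl, hl0⟩ := main (Submodule.span ℝ D) (by
      rw [Submodule.span_le]
      rintro _ ⟨x, hx, rfl⟩
      exact F.sub_mem (hR hx.1) (hR hr)) (by omega)
    refine ⟨l, l r, hl, fun x hx => ?_⟩
    by_cases hxr : x = r
    · rw [hxr]
    · have := hl0 (x - r) (Submodule.subset_span ⟨x, ⟨hx, hxr⟩, rfl⟩)
      rw [map_sub] at this
      linarith

theorem mem_convexHull_three {S : Set V} {a b c : V} {α β γ : ℝ}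
    (ha : a ∈ convexHull ℝ S) (hb : b ∈ convexHull ℝ S) (hc : γ = 0 ∨ c ∈ convexHull ℝ S)
    (hα : 0 ≤ α) (hβ : 0 ≤ β) (hγ : 0 ≤ γ) (h1 : α + β + γ = 1) :
    α • a + β • b + γ • c ∈ convexHull ℝ S := by
  rcases hc with rfl | hc
  · simpa using (convex_convexHull ℝ S) ha hb hα hβ (by linarith)
  · have hcv := convex_convexHull ℝ S
    have := hcv.sum_mem (t := (Finset.univ : Finset (Fin 3))) (w := ![α, β, γ])
      (z := ![a, b, c]) (by intro i _; fin_cases i <;> simpa)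
      (by simp [Fin.sum_univ_three, h1]) (by intro i _; fin_cases i <;> simpa)
    simpa [Fin.sum_univ_three] using this

theorem exists_of_mem_convexHull_insert_insert {R : Set V} {a b x : V}
    (hx : x ∈ convexHull ℝ (insert a (insert b R))) :
    ∃ (α β γ : ℝ) (r : V), 0 ≤ α ∧ 0 ≤ β ∧ 0 ≤ γ ∧ α + β + γ = 1 ∧
      (γ = 0 ∨ r ∈ convexHull ℝ R) ∧ x = α • a + β • b + γ • r := by
  rcases R.eq_empty_or_nonempty with rfl | hR
  · rw [insert_empty_eq, convexHull_pair] at hx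
    obtain ⟨s, t, hs, ht, hst, rfl⟩ := hx
    exact ⟨s, t, 0, 0, hs, ht, le_rfl, by linarith, Or.inl rfl, by simp⟩
  · rw [convexHull_insert (Set.insert_nonempty _ _), convexHull_insert hR] at hx
    simp only [convexJoin_singleton_left, Set.mem_iUnion, exists_prop] at hx
    obtain ⟨y, ⟨r, hr, s, t, hs, ht, hst, rfl⟩, s', t', hs', ht', hst', rfl⟩ := hx
    refine ⟨s', t' * s, t' * t, r, hs', by positivity, by positivity, ?_, Or.inr hr, ?_⟩
    · rw [add_assoc, ← mul_add, hst, mul_one, hst']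
    · module

theorem convexHull_insert_insert_eq_union {R : Set V} {a b p : V} (hp : p ∈ segment ℝ a b) :
    convexHull ℝ (insert a (insert b R)) =
      convexHull ℝ (insert a (insert p R)) ∪ convexHull ℝ (insert p (insert b R)) := by
  obtain ⟨s, t, hs, ht, hst, rfl⟩ := hp
  set p := s • a + t • b with hpdef
  apply Set.Subset.antisymm
  · intro x hx
    obtain ⟨α, β, γ, r, hα, hβ, hγ, h1, hr, rfl⟩ := exists_of_mem_convexHull_insert_insert hx
    have hr' : ∀ {S : Set V}, R ⊆ S → (γ = 0 ∨ r ∈ convexHull ℝ S) := fun h =>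
      hr.imp_right fun h' => convexHull_mono h h'
    have hmem : ∀ {S : Set V} {y : V}, y ∈ S → y ∈ convexHull ℝ S :=
      fun h => subset_convexHull ℝ _ h
    by_cases hcase : β * s ≤ α * t
    · left
      by_cases ht0 : t = 0
      · have hs1 : s = 1 := by linarith
        have hβ0 : β = 0 := by rw [hs1, ht0] at hcase; linarith
        have : α • a + β • b + γ • r = α • a + 0 • p + γ • r := by rw [hβ0]; simp
        rw [this]
        simpa using mem_convexHull_three (β := 0) (hmem (by simp)) (hmem (y := p) (by simp)) (hr' (by
          intro z hz; simp [hz])) hα le_rfl hγ (by linarith)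
      · have htpos : 0 < t := lt_of_le_of_ne ht (Ne.symm ht0)
        have : α • a + β • b + γ • r = (α - β * s / t) • a + (β / t) • p + γ • r := by
          rw [hpdef]
          have e : (β / t) • (s • a + t • b) = (β * s / t) • a + β • b := by
            rw [smul_add, smul_smul, smul_smul, div_mul_cancel₀ _ ht0]
            congr 2; ring
          rw [e]; module
        rw [this]
        refine mem_convexHull_three (hmem (by simp)) (hmem (by simp)) (hr' (by
          intro z hz; simp [hz])) ?_ (by positivity) hγ ?_
        · rw [sub_nonneg, div_le_iff₀ htpos]; exact hcase
        · field_simp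
          have : s = 1 - t := by linarith
          rw [this]; nlinarith
    · right
      push Not at hcase
      have hs0 : s ≠ 0 := by
        rintro rfl
        have : 0 ≤ α * t := by positivity
        linarith
      have hspos : 0 < s := lt_of_le_of_ne hs (Ne.symm hs0)
      have : α • a + β • b + γ • r = (α / s) • p + (β - α * t / s) • b + γ • r := by
        rw [hpdef]
        have e : (α / s) • (s • a + t • b) = α • a + (α * t / s) • b := by
          rw [smul_add, smul_smul, smul_smul, div_mul_cancel₀ _ hs0]
          congr 2; ring
        rw [e]; module
      rw [this]
      refine mem_convexHull_three (hmem (by simp)) (hmem (by simp)) (hr' (by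
          intro z hz; simp [hz])) (by positivity) ?_ hγ ?_
      · rw [sub_nonneg, div_le_iff₀ hspos]; exact hcase.le
      · field_simp
        have : t = 1 - s := by linarith
        rw [this]; nlinarith
  · have ha : a ∈ convexHull ℝ (insert a (insert b R)) := subset_convexHull ℝ _ (by simp)
    have hb : b ∈ convexHull ℝ (insert a (insert b R)) := subset_convexHull ℝ _ (by simp)
    have hp : p ∈ convexHull ℝ (insert a (insert b R)) :=
      (convex_convexHull ℝ _) ha hb hs ht hst
    have hR : R ⊆ convexHull ℝ (insert a (insert b R)) := fun x hx =>
      subset_convexHull ℝ _ (by simp [hx])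
    apply Set.union_subset
    · exact convexHull_min (Set.insert_subset ha (Set.insert_subset hp hR))
        (convex_convexHull ℝ _)
    · exact convexHull_min (Set.insert_subset hp (Set.insert_subset hb hR))
        (convex_convexHull ℝ _)

/-- Dissection of a simplex, intersected with a closed convex set, by a hyperplane passing
through all vertices but two. -/
theorem extendByZero_split_inter [FiniteDimensional ℝ V] {μ : ConvexBody V → ℝ}
    (hμ : IsValuation μ) {F : Submodule ℝ V} (hF : IsSimpleOn μ F) {R : Set V} {a b p : V}
    (ha : a ∈ F) (hb : b ∈ F) (hR : R ⊆ F) (hfin : R.Finite)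
    (hcard : R.ncard + 1 ≤ finrank ℝ F) (hp : p ∈ segment ℝ a b)
    {Y : Set V} (hY : Convex ℝ Y) (hY' : IsClosed Y) :
    extendByZero μ (convexHull ℝ (insert a (insert b R)) ∩ Y) =
      extendByZero μ (convexHull ℝ (insert a (insert p R)) ∩ Y) +
        extendByZero μ (convexHull ℝ (insert p (insert b R)) ∩ Y) := by
  have hpF : p ∈ F := F.convex.segment_subset ha hb hp
  obtain ⟨l, c, hl, hc⟩ := exists_functional_const_on (F := F) (R := insert p R)
    (Set.insert_subset hpF hR) (hfin.insert p) (by omega)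
    ((Set.ncard_insert_le p R).trans hcard)
  have hunion := convexHull_insert_insert_eq_union (R := R) hp
  have hlp : l p = c := hc p (by simp)
  have hsub : convexHull ℝ (insert a (insert b R)) ⊆ F :=
    convexHull_min (Set.insert_subset ha (Set.insert_subset hb hR)) F.convex
  have hcompact : ∀ x y : V, IsCompact (convexHull ℝ (insert x (insert y R))) := fun x y =>
    ((hfin.insert y).insert x).isCompact_convexHull ℝ
  rw [hunion, Set.union_inter_distrib_right]
  apply extendByZero_union hμ ((convex_convexHull ℝ _).inter hY) ((hcompact a p).inter_right hY')
    ((convex_convexHull ℝ _).inter hY) ((hcompact p b).inter_right hY')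
  · rw [← Set.union_inter_distrib_right, ← hunion]
    exact (convex_convexHull ℝ _).inter hY
  · refine hF.extendByZero (fun x hx => hsub ?_) l c hl ?_
    · rw [hunion]; exact Or.inl hx.1.1
    · have hle : ∀ x y : V, l x ≤ c → l y ≤ c →
          convexHull ℝ (insert x (insert y R)) ⊆ {z | l z ≤ c} := fun x y hx hy =>
        convexHull_min (Set.insert_subset hx (Set.insert_subset hy
          fun z hz => (hc z (by simp [hz])).le)) (convex_halfSpace_le l.isLinear c)
      have hge : ∀ x y : V, c ≤ l x → c ≤ l y →
          convexHull ℝ (insert x (insert y R)) ⊆ {z | c ≤ l z} := fun x y hx hy =>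
        convexHull_min (Set.insert_subset hx (Set.insert_subset hy
          fun z hz => (hc z (by simp [hz])).ge)) (convex_halfSpace_ge l.isLinear c)
      rintro x ⟨⟨hx1, -⟩, ⟨hx2, -⟩⟩
      have hsides : (l a ≤ c ∧ c ≤ l b) ∨ (c ≤ l a ∧ l b ≤ c) := by
        obtain ⟨s, t, hs, ht, hst, rfl⟩ := hp
        simp only [map_add, map_smul, smul_eq_mul] at hlp
        have ht' : t = 1 - s := by linarith
        subst ht'
        by_contra! hcon
        rcases lt_or_ge (l a) c with h | h
        · have := hcon.1 h.le
          rcases hs.eq_or_lt with hs0 | hs0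
          · rw [← hs0] at hlp; linarith
          · nlinarith
        · have := hcon.2 h
          rcases hs.eq_or_lt with hs0 | hs0
          · rw [← hs0] at hlp; linarith
          · rcases h.eq_or_lt with h0 | h0
            · exact absurd (hcon.1 h0.ge) (by linarith)
            · nlinarith
      rcases hsides with ⟨h, h'⟩ | ⟨h, h'⟩
      · exact le_antisymm (hle _ _ h hlp.le hx1) (hge _ _ hlp.ge h' hx2)
      · exact le_antisymm (hle _ _ hlp.le h' hx2) (hge _ _ h hlp.ge hx1)

theorem extendByZero_split [FiniteDimensional ℝ V] {μ : ConvexBody V → ℝ}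
    (hμ : IsValuation μ) {F : Submodule ℝ V} (hF : IsSimpleOn μ F) {R : Set V} {a b p : V}
    (ha : a ∈ F) (hb : b ∈ F) (hR : R ⊆ F) (hfin : R.Finite)
    (hcard : R.ncard + 1 ≤ finrank ℝ F) (hp : p ∈ segment ℝ a b) :
    extendByZero μ (convexHull ℝ (insert a (insert b R))) =
      extendByZero μ (convexHull ℝ (insert a (insert p R))) +
        extendByZero μ (convexHull ℝ (insert p (insert b R))) := by
  simpa using extendByZero_split_inter hμ hF ha hb hR hfin hcard hp convex_univ isClosed_univ

end Dissection

section Vanishing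

variable {V : Type*} [NormedAddCommGroup V] [NormedSpace ℝ V]

theorem exists_mem_segment_eq (l : V →L[ℝ] ℝ) {a b : V} {c : ℝ} (ha : c ≤ l a) (hb : l b ≤ c) :
    ∃ p ∈ segment ℝ a b, l p = c := by
  rcases eq_or_ne (l a) (l b) with h | h
  · exact ⟨a, left_mem_segment ℝ a b, le_antisymm (h ▸ hb) ha⟩
  · have hpos : 0 < l a - l b := lt_of_le_of_ne (by linarith) (sub_ne_zero.2 h).symm
    refine ⟨((c - l b) / (l a - l b)) • a + ((l a - c) / (l a - l b)) • b,
      ⟨_, _, div_nonneg (by linarith) hpos.le, div_nonneg (by linarith) hpos.le, ?_, rfl⟩, ?_⟩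
    · field_simp; ring
    · simp only [map_add, map_smul, smul_eq_mul]
      field_simp; ring

theorem extendByZero_simplex_inter_halfSpaces [FiniteDimensional ℝ V] {μ : ConvexBody V → ℝ}
    (hμ : IsValuation μ) {F : Submodule ℝ V} (hF : IsSimpleOn μ F)
    (hsimplex : ∀ S : Set V, S ⊆ F → S.Finite → S.ncard ≤ finrank ℝ F + 1 →
      extendByZero μ (convexHull ℝ S) = 0)
    (H : List ((V →L[ℝ] ℝ) × ℝ)) {S : Set V} (hS : S ⊆ F) (hfin : S.Finite)
    (hcard : S.ncard ≤ finrank ℝ F + 1) :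
    extendByZero μ (convexHull ℝ S ∩ {x | ∀ h ∈ H, h.1 x ≤ h.2}) = 0 := by
  induction H generalizing S with
  | nil => simpa using hsimplex S hS hfin hcard
  | cons lc H ih =>
    obtain ⟨l, c⟩ := lc
    set Y : Set V := {x | ∀ h ∈ (l, c) :: H, h.1 x ≤ h.2} with hYdef
    have hYconv : Convex ℝ Y := by
      have : Y = ⋂ h ∈ (l, c) :: H, {x : V | h.1 x ≤ h.2} := by ext; simp [Y]
      rw [this]
      exact convex_iInter₂ fun h _ => convex_halfSpace_le h.1.isLinear h.2
    have hYclosed : IsClosed Y := by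
      have : Y = ⋂ h ∈ (l, c) :: H, {x : V | h.1 x ≤ h.2} := by ext; simp [Y]
      rw [this]
      exact isClosed_biInter fun h _ => isClosed_le h.1.continuous continuous_const
    induction hN : {x ∈ S | l x ≠ c}.ncard using Nat.strong_induction_on generalizing S with
    | _ N ihN =>
    subst hN
    by_cases hle : ∀ x ∈ S, l x ≤ c
    · have hsub : convexHull ℝ S ⊆ {x | l x ≤ c} :=
        convexHull_min hle (convex_halfSpace_le l.isLinear c)
      have heq : convexHull ℝ S ∩ Y = convexHull ℝ S ∩ {x | ∀ h ∈ H, h.1 x ≤ h.2} := by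
        ext x
        simp only [hYdef, Set.mem_inter_iff, Set.mem_ofPred_eq, List.forall_mem_cons]
        exact ⟨fun h => ⟨h.1, h.2.2⟩, fun h => ⟨h.1, hsub h.1, h.2⟩⟩
      rw [heq]
      exact ih hS hfin hcard
    push Not at hle
    obtain ⟨a, haS, ha⟩ := hle
    by_cases hge : ∀ x ∈ S, c ≤ l x
    · have hsub : convexHull ℝ S ⊆ {x | c ≤ l x} :=
        convexHull_min hge (convex_halfSpace_ge l.isLinear c)
      have hconst : ∀ x ∈ convexHull ℝ S ∩ Y, l x = c := fun x hx =>
        le_antisymm (hx.2 (l, c) (by simp)) (hsub hx.1)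
      have hSF : convexHull ℝ S ⊆ F := convexHull_min hS F.convex
      by_cases hl : ∃ x ∈ F, l x ≠ 0
      · exact hF.extendByZero (fun x hx => hSF hx.1) l c hl hconst
      · push Not at hl
        refine extendByZero_of_forall μ fun K hK => ?_
        obtain ⟨x, hx⟩ := K.nonempty
        rw [hK] at hx
        have h1 := hconst x hx
        rw [hl x (hSF hx.1)] at h1
        rw [hl a (hS haS)] at ha
        linarith
    push Not at hge
    obtain ⟨b, hbS, hb⟩ := hge
    obtain ⟨p, hp, hlp⟩ := exists_mem_segment_eq l ha.le hb.le
    have hab : a ≠ b := by rintro rfl; linarith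
    set R := S \ {a, b} with hR
    have hSeq : S = insert a (insert b R) := by
      ext x
      simp only [hR, Set.mem_insert_iff, Set.mem_sdiff, Set.mem_singleton_iff]
      constructor
      · intro hx; by_cases x = a <;> by_cases x = b <;> simp_all
      · rintro (rfl | rfl | h)
        exacts [haS, hbS, h.1]
    have hRfin : R.Finite := hfin.subset Set.sdiff_subset
    have hRF : R ⊆ F := Set.sdiff_subset.trans hS
    have hRcard : R.ncard + 2 = S.ncard := by
      conv_rhs => rw [hSeq]
      rw [Set.ncard_insert_of_notMem (by simp [hR, hab]) (hRfin.insert b),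
        Set.ncard_insert_of_notMem (by simp [hR]) hRfin]
    have hpF : p ∈ F := F.convex.segment_subset (hS haS) (hS hbS) hp
    have hcardle : ∀ x y : V, (insert x (insert y R)).ncard ≤ finrank ℝ F + 1 := fun x y => by
      have h1 := Set.ncard_insert_le x (insert y R)
      have h2 := Set.ncard_insert_le y R
      omega
    have hlt : ∀ (S' : Set V) (z : V), z ∈ S → l z ≠ c →
        {x ∈ S' | l x ≠ c} ⊆ {x ∈ S | l x ≠ c} \ {z} →
        {x ∈ S' | l x ≠ c}.ncard < {x ∈ S | l x ≠ c}.ncard := fun S' z hz hz' hsub => by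
      have hf : {x ∈ S | l x ≠ c}.Finite := hfin.subset (Set.sep_subset _ _)
      exact (Set.ncard_le_ncard hsub (hf.subset Set.sdiff_subset)).trans_lt
        (Set.ncard_sdiff_singleton_lt_of_mem ⟨hz, hz'⟩ hf)
    rw [hSeq, extendByZero_split_inter hμ hF (hS haS) (hS hbS) hRF hRfin (by omega) hp hYconv
      hYclosed]
    rw [ihN _ (hlt (insert a (insert p R)) b hbS hb.ne ?_)
        (Set.insert_subset (hS haS) (Set.insert_subset hpF hRF)) ((hRfin.insert p).insert a)
        (hcardle a p) rfl,
      ihN _ (hlt (insert p (insert b R)) a haS ha.ne' ?_)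
        (Set.insert_subset hpF (Set.insert_subset (hS hbS) hRF)) ((hRfin.insert b).insert p)
        (hcardle p b) rfl, add_zero]
    · rintro x ⟨rfl | rfl | hx, hxc⟩
      · exact absurd hlp hxc
      · exact ⟨⟨hbS, hxc⟩, hab.symm⟩
      · exact ⟨⟨hx.1, hxc⟩, fun h => hx.2 (Or.inl h)⟩
    · rintro x ⟨rfl | rfl | hx, hxc⟩
      · exact ⟨⟨haS, hxc⟩, hab⟩
      · exact absurd hlp hxc
      · exact ⟨⟨hx.1, hxc⟩, fun h => hx.2 (Or.inr h)⟩

theorem exists_simplex_superset [FiniteDimensional ℝ V] {F : Submodule ℝ V} (K : ConvexBody V)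
    (hK : (K : Set V) ⊆ F) :
    ∃ S : Set V, S ⊆ F ∧ S.Finite ∧ S.ncard ≤ finrank ℝ F + 1 ∧ (K : Set V) ⊆ convexHull ℝ S := by
  set b := Module.finBasis ℝ F with hb
  set d := finrank ℝ F
  have hcont : Continuous fun x : F => b.equivFun x := LinearMap.continuous_of_finiteDimensional
    (b.equivFun : F →ₗ[ℝ] (Fin d → ℝ))
  obtain ⟨M, hM⟩ := (bodyIn F K hK).isCompact.exists_bound_of_continuousOn hcont.continuousOn
  have hM0 : 0 ≤ M := by
    obtain ⟨x, hx⟩ := (bodyIn F K hK).nonempty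
    exact (norm_nonneg _).trans (hM x hx)
  set C : ℝ := 2 * d * M + 1 with hC
  have hCpos : 0 < C := by positivity
  set v : V := -(M • ∑ i, (b i : V)) with hv
  have hvF : v ∈ F := F.neg_mem (F.smul_mem _ (F.sum_mem fun i _ => (b i).2))
  refine ⟨insert v (Set.range fun i => v + C • (b i : V)), ?_, (Set.finite_range _).insert _,
    ?_, ?_⟩
  · apply Set.insert_subset hvF
    rintro _ ⟨i, rfl⟩
    exact F.add_mem hvF (F.smul_mem _ (b i).2)
  · refine (Set.ncard_insert_le _ _).trans (Nat.add_le_add_right ?_ 1)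
    rw [← Set.image_univ]
    refine (Set.ncard_image_le).trans ?_
    simp [Set.ncard_univ, d]
  · intro x hx
    set c := b.equivFun ⟨x, hK hx⟩ with hc
    have hcM : ∀ i, |c i| ≤ M := fun i =>
      (norm_le_pi_norm c i).trans (hM ⟨x, hK hx⟩ hx)
    have hxsum : x = ∑ i, c i • (b i : V) := by
      have := congrArg Subtype.val (b.sum_equivFun ⟨x, hK hx⟩)
      simpa only [Submodule.coe_sum, Submodule.coe_smul] using this.symm
    have hw : ∑ i, (c i + M) / C ≤ 1 := by
      rw [← Finset.sum_div, div_le_one hCpos]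
      calc ∑ i, (c i + M) ≤ ∑ _i : Fin d, 2 * M :=
            Finset.sum_le_sum fun i _ => by linarith [(abs_le.1 (hcM i)).2]
        _ ≤ C := by simp [hC]; linarith
    have hmem := (convex_convexHull ℝ (insert v (Set.range fun i => v + C • (b i : V)))).sum_mem
      (t := (Finset.univ : Finset (Option (Fin d))))
      (w := fun o => o.elim (1 - ∑ i, (c i + M) / C) fun i => (c i + M) / C)
      (z := fun o => o.elim v fun i => v + C • (b i : V)) (by
        rintro (_ | i) -
        · simpa using hw
        · exact div_nonneg (by linarith [(abs_le.1 (hcM i)).1]) hCpos.le)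
      (by simp [Fintype.sum_option]) (by
        rintro (_ | i) -
        · exact subset_convexHull ℝ _ (by simp)
        · exact subset_convexHull ℝ _ (by simp))
    convert hmem using 1
    simp only [Fintype.sum_option, Option.elim_none, Option.elim_some, smul_add,
      Finset.sum_add_distrib, smul_smul, div_mul_cancel₀ _ hCpos.ne', add_smul]
    rw [← Finset.sum_smul, sub_smul, one_smul, ← Finset.smul_sum, hv, ← hxsum]
    module

/-- A continuous simple valuation on `F` that vanishes on simplices vanishes. -/
theorem eq_zero_of_simplices [FiniteDimensional ℝ V] {μ : ConvexBody V → ℝ}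
    (hc : Continuous μ) (hμ : IsValuation μ) {F : Submodule ℝ V} (hF : IsSimpleOn μ F)
    (hsimplex : ∀ S : Set V, S ⊆ F → S.Finite → S.ncard ≤ finrank ℝ F + 1 →
      extendByZero μ (convexHull ℝ S) = 0)
    (K : ConvexBody V) (hK : (K : Set V) ⊆ F) : μ K = 0 := by
  obtain ⟨S, hSF, hSfin, hScard, hKS⟩ := exists_simplex_superset K hK
  have happrox : ∀ ε > 0, ∃ P : ConvexBody V, dist P K ≤ ε ∧ μ P = 0 := by
    intro ε hε
    set T := convexHull ℝ S \ Metric.thickening ε (K : Set V) with hT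
    have hTc : IsCompact T := (hSfin.isCompact_convexHull ℝ).diff Metric.isOpen_thickening
    have hsep : ∀ x : V, ∃ lc : (V →L[ℝ] ℝ) × ℝ, x ∈ T →
        (∀ y ∈ (K : Set V), lc.1 y ≤ lc.2) ∧ lc.2 < lc.1 x := by
      intro x
      by_cases hx : x ∈ T
      · have hxK : x ∉ (K : Set V) := fun h => hx.2 (Metric.self_subset_thickening hε _ h)
        obtain ⟨l, c, h1, h2⟩ := geometric_hahn_banach_closed_point K.convex K.isClosed hxK
        exact ⟨(l, c), fun _ => ⟨fun y hy => (h1 y hy).le, h2⟩⟩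
      · exact ⟨(0, 0), fun h => absurd h hx⟩
    choose lc hlc using hsep
    obtain ⟨t, htT, ht⟩ := hTc.elim_nhds_subcover (fun x => {z | (lc x).2 < (lc x).1 z})
      fun x hx => (isOpen_lt continuous_const (lc x).1.continuous).mem_nhds (hlc x hx).2
    set Y : Set V := {x | ∀ h ∈ t.toList.map lc, h.1 x ≤ h.2} with hY
    have hYeq : Y = ⋂ h ∈ t.toList.map lc, {x : V | h.1 x ≤ h.2} := by ext; simp [Y]
    have hKY : (K : Set V) ⊆ convexHull ℝ S ∩ Y := fun y hy => ⟨hKS hy, fun h hh => by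
      obtain ⟨x, hx, rfl⟩ := List.mem_map.1 hh
      exact (hlc x (htT x (Finset.mem_toList.1 hx))).1 y hy⟩
    let P : ConvexBody V := ⟨convexHull ℝ S ∩ Y, (convex_convexHull ℝ S).inter (by
        rw [hYeq]; exact convex_iInter₂ fun h _ => convex_halfSpace_le h.1.isLinear h.2),
      (hSfin.isCompact_convexHull ℝ).inter_right (by
        rw [hYeq]; exact isClosed_biInter fun h _ => isClosed_le h.1.continuous continuous_const),
      K.nonempty.mono hKY⟩
    refine ⟨P, ?_, ?_⟩
    · rw [← ConvexBody.hausdorffDist_coe]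
      refine Metric.hausdorffDist_le_of_mem_dist hε.le ?_ fun x hx => ⟨x, hKY hx, by simp [hε.le]⟩
      intro x hx
      have hxthick : x ∈ Metric.thickening ε (K : Set V) := by
        by_contra hxn
        obtain ⟨z, hz, hxz⟩ := Set.mem_iUnion₂.1 (ht ⟨hx.1, hxn⟩)
        exact absurd (hx.2 (lc z) (List.mem_map.2 ⟨z, Finset.mem_toList.2 hz, rfl⟩))
          (not_le.2 hxz)
      obtain ⟨y, hy, hxy⟩ := Metric.mem_thickening_iff.1 hxthick
      exact ⟨y, hy, hxy.le⟩
    · rw [← extendByZero_coe μ P]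
      exact extendByZero_simplex_inter_halfSpaces hμ hF hsimplex _ hSF hSfin hScard
  by_contra hne
  obtain ⟨δ, hδ, hδ'⟩ := Metric.continuous_iff.1 hc K |μ K| (abs_pos.2 hne)
  obtain ⟨P, hP, hP0⟩ := happrox (δ / 2) (by linarith)
  have := hδ' P (by linarith)
  rw [hP0, Real.dist_eq, zero_sub, abs_neg] at this
  exact lt_irrefl _ this

end Vanishing

section Components

theorem eq_of_forall_sum_pow_mul_eq {n : ℕ} {a b : ℕ → ℝ}
    (h : ∀ t : ℝ, 0 < t → ∑ i ∈ Finset.range n, t ^ i * a i = ∑ i ∈ Finset.range n, t ^ i * b i)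
    {i : ℕ} (hi : i < n) : a i = b i := by
  set p : (ℕ → ℝ) → Polynomial ℝ := fun c =>
    ∑ i ∈ Finset.range n, Polynomial.C (c i) * Polynomial.X ^ i with hp
  have heval : ∀ (c : ℕ → ℝ) (t : ℝ), (p c).eval t = ∑ i ∈ Finset.range n, t ^ i * c i :=
    fun c t => by
      simp only [hp, Polynomial.eval_finsetSum, Polynomial.eval_mul, Polynomial.eval_C,
        Polynomial.eval_pow, Polynomial.eval_X]
      exact Finset.sum_congr rfl fun i _ => mul_comm _ _
  have hcoeff : ∀ c : ℕ → ℝ, (p c).coeff i = c i := fun c => by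
    simp [hp, Polynomial.coeff_X_pow, hi]
  have hpq : p a = p b := Polynomial.eq_of_infinite_eval_eq _ _
    ((Set.Ioi_infinite (0 : ℝ)).mono fun t ht => by
      simp only [Set.mem_ofPred_eq, heval]; exact h t ht)
  rw [← hcoeff a, hpq, hcoeff]

theorem nonneg_of_forall_sum_pow_mul_nonneg {n k : ℕ} {a : ℕ → ℝ} (hk : k < n)
    (h : ∀ t : ℝ, 0 < t → 0 ≤ ∑ i ∈ Finset.range n, t ^ i * a i)
    (h0 : ∀ i, k < i → i < n → a i = 0) : 0 ≤ a k := by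
  have hsum : ∀ t : ℝ, ∑ i ∈ Finset.range n, t ^ i * a i =
      ∑ i ∈ Finset.range k, t ^ i * a i + t ^ k * a k := fun t => by
    rw [← Finset.sum_range_succ]
    symm
    apply Finset.sum_subset (Finset.range_mono hk)
    intro i hi hi'
    rw [h0 i (by simp at hi'; omega) (by simpa using hi), mul_zero]
  have hlim : Filter.Tendsto (fun t : ℝ => ∑ i ∈ Finset.range k, t ^ i / t ^ k * a i + a k)
      Filter.atTop (nhds (∑ i ∈ Finset.range k, 0 * a i + a k)) :=
    (tendsto_finsetSum _ fun i hi =>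
      (tendsto_pow_div_pow_atTop_zero (Finset.mem_range.1 hi)).mul_const _).add_const _
  simp only [zero_mul, Finset.sum_const_zero, zero_add] at hlim
  refine ge_of_tendsto hlim ?_
  filter_upwards [Filter.eventually_gt_atTop 0] with t ht
  have h1 := h t ht
  rw [hsum] at h1
  have htk : 0 < t ^ k := pow_pos ht k
  have h2 : ∑ i ∈ Finset.range k, t ^ i / t ^ k * a i + a k =
      (∑ i ∈ Finset.range k, t ^ i * a i + t ^ k * a k) / t ^ k := by
    rw [add_div, mul_div_cancel_left₀ _ htk.ne', Finset.sum_div]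
    congr 1
    exact Finset.sum_congr rfl fun i _ => by ring
  rw [h2]
  positivity

theorem hSupp_mapCLM {V V' : Type*} [NormedAddCommGroup V] [NormedSpace ℝ V]
    [NormedAddCommGroup V'] [NormedSpace ℝ V'] (g : V →L[ℝ] V') (K : ConvexBody V)
    (p : V' → ℝ) : hSupp (K.mapCLM g) p = hSupp K (fun x => p (g x)) := by
  unfold hSupp
  congr 1
  exact Set.image_image p g K

theorem le_hSupp {V : Type*} [NormedAddCommGroup V] [NormedSpace ℝ V] (K : ConvexBody V)
    {p : V → ℝ} (hp : Continuous p) {x : V} (hx : x ∈ (K : Set V)) : p x ≤ hSupp K p :=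
  le_csSup (K.isCompact.image hp).bddAbove (Set.mem_image_of_mem _ hx)

theorem hSupp_add_le {V : Type*} [NormedAddCommGroup V] [NormedSpace ℝ V] (K : ConvexBody V)
    {p q : V → ℝ} (hp : Continuous p) (hq : Continuous q) :
    hSupp K (fun x => p x + q x) ≤ hSupp K p + hSupp K q := by
  refine csSup_le (K.nonempty.image _) ?_
  rintro _ ⟨x, hx, rfl⟩
  exact add_le_add (le_hSupp K hp hx) (le_hSupp K hq hx)

theorem mapCLM_smul {V V' : Type*} [NormedAddCommGroup V] [NormedSpace ℝ V]
    [NormedAddCommGroup V'] [NormedSpace ℝ V'] (g : V →L[ℝ] V') (K : ConvexBody V) (t : ℝ) :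
    (t • K).mapCLM g = t • K.mapCLM g := by
  apply SetLike.coe_injective
  rw [ConvexBody.coe_smul]
  change g '' ((t • K : ConvexBody V) : Set V) = t • (g '' (K : Set V))
  rw [ConvexBody.coe_smul, Set.image_smul_comm]
  exact fun x => map_smul g t x

variable {W : Type*} [NormedAddCommGroup W] [NormedSpace ℂ W]

theorem component_mapCLM [FiniteDimensional ℂ W] {Z : ConvexBody W → ConvexBody (W →L[ℂ] ℂ)} (hZg : IsSLContravariant Z)
    {f : ℕ → ConvexBody W → W → ℝ} (hf : McMullenProps f)
    (hsum : ∀ (K : ConvexBody W) (u : W),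
      hSupp (Z K) (fun ξ => (ξ u).re) = ∑ i ∈ Finset.range 5, f i K u)
    (g : W ≃L[ℂ] W) (hg : LinearMap.det ((g : W →L[ℂ] W) : W →ₗ[ℂ] W) = 1) {i : ℕ} (hi : i < 5)
    (K : ConvexBody W) (u : W) :
    f i (K.mapCLM (cReal (g : W →ₗ[ℂ] W))) u = f i K (g.symm u) := by
  refine eq_of_forall_sum_pow_mul_eq (a := fun i => f i (K.mapCLM (cReal (g : W →ₗ[ℂ] W))) u)
    (b := fun i => f i K (g.symm u)) (fun t ht => ?_) hi
  have h1 := hsum ((t • K).mapCLM (cReal (g : W →ₗ[ℂ] W))) u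
  have h2 := hsum (t • K) (g.symm u)
  rw [hZg g hg, hSupp_mapCLM] at h1
  have h3 := h1.symm.trans h2
  rw [mapCLM_smul] at h3
  simpa only [hf.2.2.2.1 _ _ _ t ht] using h3

theorem component_add_le {Z : ConvexBody W → ConvexBody (W →L[ℂ] ℂ)}
    {f : ℕ → ConvexBody W → W → ℝ} (hf : McMullenProps f)
    (hsum : ∀ (K : ConvexBody W) (u : W),
      hSupp (Z K) (fun ξ => (ξ u).re) = ∑ i ∈ Finset.range 5, f i K u)
    {k : ℕ} (hk : k < 5) (K : ConvexBody W) (u v : W)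
    (h0 : ∀ i, k < i → i < 5 → f i K (u + v) = f i K u + f i K v) :
    f k K (u + v) ≤ f k K u + f k K v := by
  have := nonneg_of_forall_sum_pow_mul_nonneg (k := k) hk
    (a := fun i => f i K u + f i K v - f i K (u + v)) (fun t ht => ?_)
    (fun i hi hi' => by simp [h0 i hi hi'])
  · linarith
  · have hcont : ∀ w : W, Continuous fun ξ : W →L[ℂ] ℂ => (ξ w).re := fun w =>
      Complex.continuous_re.comp (ContinuousLinearMap.apply ℂ ℂ w).continuous
    have h1 := hSupp_add_le (Z (t • K)) (hcont u) (hcont v)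
    have h2 := hsum (t • K) (u + v)
    simp only [map_add, Complex.add_re] at h2
    rw [h2, hsum, hsum] at h1
    simp only [hf.2.2.2.1 _ _ _ t ht] at h1
    simp only [mul_sub, mul_add, Finset.sum_sub_distrib, Finset.sum_add_distrib]
    linarith

end Components

section LowDimension

variable {V : Type*} [NormedAddCommGroup V] [NormedSpace ℝ V]

theorem extendByZero_convexHull_image {μ ν : ConvexBody V → ℝ} {F : Set V} (hF : Convex ℝ F)
    (L : V →L[ℝ] V) (x : V) (c : ℝ)
    (h : ∀ K K' : ConvexBody V, (K : Set V) ⊆ F → (K' : Set V) = (fun y => L y + x) '' K →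
      μ K' = c * ν K)
    {S : Set V} (hS : S.Finite) (hSF : S ⊆ F) :
    extendByZero μ (convexHull ℝ ((fun y => L y + x) '' S)) =
      c * extendByZero ν (convexHull ℝ S) := by
  rcases S.eq_empty_or_nonempty with rfl | hne
  · simp [extendByZero]
  · have h1 : extendByZero ν (convexHull ℝ S) = _ := extendByZero_eq ν
      ⟨convexHull ℝ S, convex_convexHull ℝ S, hS.isCompact_convexHull ℝ, hne.convexHull⟩ rfl
    have h2 : extendByZero μ (convexHull ℝ ((fun y => L y + x) '' S)) = _ := extendByZero_eq μ
      ⟨convexHull ℝ ((fun y => L y + x) '' S), convex_convexHull ℝ _,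
        (hS.image _).isCompact_convexHull ℝ, (hne.image _).convexHull⟩ rfl
    rw [h1, h2]
    apply h _ _ (convexHull_min hSF hF)
    exact (AffineMap.image_convexHull
      ((L : V →ₗ[ℝ] V).toAffineMap + AffineMap.const ℝ V x) S).symm

theorem Set.Finite.exists_range_eq {α : Type*} {S : Set α} (hS : S.Finite) (hne : S.Nonempty)
    {n : ℕ} (hn : S.ncard ≤ n) : ∃ g : Fin n → α, Set.range g = S := by
  have := hS.fintype
  have := hne.to_subtype
  obtain ⟨e⟩ := Function.Embedding.nonempty_of_card_le (α := S) (β := Fin n) (by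
    rw [← Nat.card_eq_fintype_card, Nat.card_coe_set_eq, Fintype.card_fin]; exact hn)
  refine ⟨fun i => (Function.invFun e i : S), ?_⟩
  rw [Set.range_comp' Subtype.val, (Function.invFun_surjective e.injective).range_eq]
  simp

/-- The value of a functional on the triangle with the given vertices. -/
def triangleValue (μ : ConvexBody V → ℝ) (a b c : V) : ℝ :=
  extendByZero μ (convexHull ℝ {a, b, c})

theorem triangleValue_swap (μ : ConvexBody V → ℝ) (a b c : V) :
    triangleValue μ a b c = triangleValue μ b a c := by
  unfold triangleValue; rw [Set.insert_comm]

theorem triangleValue_rotate (μ : ConvexBody V → ℝ) (a b c : V) :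
    triangleValue μ a b c = triangleValue μ b c a := by
  unfold triangleValue; rw [Set.insert_comm, Set.pair_comm a c]

theorem triangleValue_swap_right (μ : ConvexBody V → ℝ) (a b c : V) :
    triangleValue μ a b c = triangleValue μ a c b := by
  unfold triangleValue; rw [Set.pair_comm]

theorem triangleValue_add {μ : ConvexBody V → ℝ} (ht : IsTranslationInvariant μ) (a b c x : V) :
    triangleValue μ (a + x) (b + x) (c + x) = triangleValue μ a b c := by
  have := extendByZero_convexHull_image (μ := μ) (ν := μ) convex_univ (ContinuousLinearMap.id ℝ V)
    x 1 (fun K K' _ h => ?_) (S := {a, b, c}) (by simp) (Set.subset_univ _)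
  · simpa [triangleValue, Set.image_insert_eq] using this
  · rw [one_mul, ← ht K x]
    congr 1
    apply SetLike.coe_injective
    rw [h]
    exact Set.image_congr fun y _ => add_comm _ _

theorem triangleValue_smul {μ : ConvexBody V → ℝ} {i : ℕ}
    (hh : ∀ (K : ConvexBody V) (t : ℝ), 0 < t → μ (t • K) = t ^ i * μ K) (a b c : V) {t : ℝ}
    (ht : 0 < t) :
    triangleValue μ (t • a) (t • b) (t • c) = t ^ i * triangleValue μ a b c := by
  have := extendByZero_convexHull_image (μ := μ) (ν := μ) convex_univ
    (t • ContinuousLinearMap.id ℝ V) 0 (t ^ i) (fun K K' _ h => ?_) (S := {a, b, c}) (by simp)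
    (Set.subset_univ _)
  · simpa [triangleValue, Set.image_insert_eq] using this
  · rw [← hh K t ht]
    congr 1
    apply SetLike.coe_injective
    rw [h, ConvexBody.coe_smul]
    exact Set.image_congr fun y _ => by simp

theorem isSimpleOn_of_forall_finrank_lt [FiniteDimensional ℝ V] {μ : ConvexBody V → ℝ}
    (ht : IsTranslationInvariant μ) {F : Submodule ℝ V}
    (h : ∀ G : Submodule ℝ V, finrank ℝ G < finrank ℝ F → ∀ K : ConvexBody V, (K : Set V) ⊆ G →
      μ K = 0) : IsSimpleOn μ F := by
  rintro K hK l c ⟨x, hxF, hx⟩ hc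
  obtain ⟨y, hy⟩ := K.nonempty
  rw [← ht K (-y)]
  refine h (F ⊓ LinearMap.ker (l : V →ₗ[ℝ] ℝ)) ?_ _ ?_
  · apply Submodule.finrank_lt_finrank_of_lt
    refine lt_of_le_of_ne inf_le_left fun heq => hx ?_
    rw [← heq] at hxF
    exact hxF.2
  · rintro _ ⟨z, hz, rfl⟩
    refine ⟨F.add_mem (F.neg_mem (hK hy)) (hK hz), ?_⟩
    simp [hc y hy, hc z hz]

theorem eq_zero_of_subset_finrank_le_one [FiniteDimensional ℝ V] {μ : ConvexBody V → ℝ}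
    (hc : Continuous μ) (hμ : IsValuation μ) (ht : IsTranslationInvariant μ) {i : ℕ} (hi : 2 ≤ i)
    (hh : ∀ (K : ConvexBody V) (t : ℝ), 0 < t → μ (t • K) = t ^ i * μ K)
    (F : Submodule ℝ V) (hF : finrank ℝ F ≤ 1) (K : ConvexBody V) (hK : (K : Set V) ⊆ F) :
    μ K = 0 := by
  have hpow : (4 : ℝ) ≤ 2 ^ i := by
    calc (4 : ℝ) = 2 ^ 2 := by norm_num
      _ ≤ 2 ^ i := pow_le_pow_right₀ (by norm_num) hi
  have hzero : ∀ (G : Submodule ℝ V), finrank ℝ G < 1 → ∀ K : ConvexBody V, (K : Set V) ⊆ G →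
      μ K = 0 := by
    intro G hG K hK
    have hG0 : G = ⊥ := Submodule.finrank_eq_zero.1 (by omega)
    subst hG0
    have hK0 : (K : Set V) = {0} := by
      obtain ⟨x, hx⟩ := K.nonempty
      refine Set.Subset.antisymm hK ?_
      rintro _ rfl
      have := hK hx
      simp only [SetLike.mem_coe, Submodule.mem_bot] at this
      rwa [this] at hx
    have h2 : (2 : ℝ) • K = K := by
      apply SetLike.coe_injective
      rw [ConvexBody.coe_smul, hK0]
      simp
    have := hh K 2 (by norm_num)
    rw [h2] at this
    nlinarith
  rcases Nat.lt_or_ge (finrank ℝ F) 1 with h | h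
  · exact hzero F h K hK
  have hF1 : finrank ℝ F = 1 := le_antisymm hF h
  have hsimple : IsSimpleOn μ F := isSimpleOn_of_forall_finrank_lt ht (by rwa [hF1])
  refine eq_zero_of_simplices hc hμ hsimple (fun S hSF hSfin hScard => ?_) K hK
  rcases S.eq_empty_or_nonempty with rfl | hne
  · simp [extendByZero]
  obtain ⟨g, rfl⟩ := hSfin.exists_range_eq hne (n := 2) (by omega)
  have hgF : ∀ j, g j ∈ F := fun j => hSF (Set.mem_range_self j)
  have hrange : Set.range g = {g 0, g 1} := by
    ext; simp [Fin.exists_fin_two, eq_comm]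
  have hpair : ∀ a b : V, extendByZero μ (convexHull ℝ {a, b}) = triangleValue μ a a b :=
    fun a b => by simp [triangleValue]
  have hsplit := extendByZero_split hμ hsimple (hgF 0) (hgF 1) (R := ∅) (by simp) (by simp)
    (by simp [hF1]) (p := (1 / 2 : ℝ) • g 0 + (1 / 2 : ℝ) • g 1)
    ⟨1 / 2, 1 / 2, by norm_num, by norm_num, by norm_num, rfl⟩
  simp only [insert_empty_eq, hpair] at hsplit
  have h1 := triangleValue_smul hh (g 0) (g 0) (g 1) (t := 1 / 2) (by norm_num)
  have h2 := triangleValue_add ht ((1 / 2 : ℝ) • g 0) ((1 / 2 : ℝ) • g 0) ((1 / 2 : ℝ) • g 1)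
    ((1 / 2 : ℝ) • g 0)
  have h3 := triangleValue_add ht ((1 / 2 : ℝ) • g 0) ((1 / 2 : ℝ) • g 0) ((1 / 2 : ℝ) • g 1)
    ((1 / 2 : ℝ) • g 1)
  have e1 : (1 / 2 : ℝ) • g 0 + (1 / 2 : ℝ) • g 0 = g 0 := by module
  have e2 : (1 / 2 : ℝ) • g 1 + (1 / 2 : ℝ) • g 1 = g 1 := by module
  rw [e1, add_comm ((1 / 2 : ℝ) • g 1)] at h2
  rw [e2] at h3
  rw [h2, h3, h1] at hsplit
  rw [hrange, hpair]
  have h4 : (1 / 2 : ℝ) ^ i ≤ 1 / 4 := by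
    rw [one_div, inv_pow, one_div]
    exact inv_anti₀ (by norm_num) hpow
  set τ := triangleValue μ (g 0) (g 0) (g 1)
  have : (1 - 2 * (1 / 2 : ℝ) ^ i) * τ = 0 := by linarith
  exact (mul_eq_zero.1 this).resolve_left (by linarith)

section Plane

variable [FiniteDimensional ℝ V] {μ : ConvexBody V → ℝ} (hμ : IsValuation μ)
  {F : Submodule ℝ V} (hF : finrank ℝ F = 2) (hs : IsSimpleOn μ F)
  (ht : IsTranslationInvariant μ)

include hμ hF hs in
theorem triangleValue_split {a b c p : V} (ha : a ∈ F) (hb : b ∈ F) (hc : c ∈ F)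
    (hp : p ∈ segment ℝ a b) :
    triangleValue μ a b c = triangleValue μ a p c + triangleValue μ p b c :=
  extendByZero_split hμ hs ha hb (R := {c}) (by simpa using hc) (by simp) (by simp [hF]) hp

include hμ hF hs ht in
theorem triangleValue_flip {v w : V} (hv : v ∈ F) (hw : w ∈ F) :
    triangleValue μ 0 v (v + w) + triangleValue μ 0 w (v + w) =
      triangleValue μ 0 v w + triangleValue μ 0 (-v) (-w) := by
  set c : V := (1 / 2 : ℝ) • v + (1 / 2 : ℝ) • w with hc
  have h0 := F.zero_mem
  have hvw := F.add_mem hv hw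
  have c1 : c ∈ segment ℝ v w := ⟨1 / 2, 1 / 2, by norm_num, by norm_num, by norm_num, rfl⟩
  have c2 : c ∈ segment ℝ 0 (v + w) :=
    ⟨1 / 2, 1 / 2, by norm_num, by norm_num, by norm_num, by rw [hc]; module⟩
  have s1 := triangleValue_split hμ hF hs h0 hvw hv c2
  have s2 := triangleValue_split hμ hF hs h0 hvw hw c2
  have s3 := triangleValue_split hμ hF hs hv hw h0 c1
  have s4 := triangleValue_split hμ hF hs hv hw hvw c1
  have t1 := triangleValue_add ht v w (v + w) (-(v + w))
  have e1 : v + -(v + w) = -w := by abel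
  have e2 : w + -(v + w) = -v := by abel
  rw [e1, e2, add_neg_cancel] at t1
  rw [triangleValue_rotate, triangleValue_swap μ (-v)] at t1
  rw [triangleValue_swap_right μ 0 v, triangleValue_swap_right μ 0 w, s1, s2, t1, s4,
    triangleValue_rotate μ 0 v w, s3, triangleValue_rotate μ 0 c v, triangleValue_rotate μ 0 c w,
    triangleValue_swap μ v c 0, triangleValue_rotate μ v c, triangleValue_swap_right μ c w (v + w)]
  ring

include hμ hF hs ht in
theorem triangleValue_two_smul {v w : V} (hv : v ∈ F) (hw : w ∈ F) :
    triangleValue μ 0 ((2 : ℝ) • v) ((2 : ℝ) • w) =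
      3 * triangleValue μ 0 v w + triangleValue μ 0 (-v) (-w) := by
  have h0 := F.zero_mem
  have hvw := F.add_mem hv hw
  have hv2 := F.smul_mem (2 : ℝ) hv
  have hw2 := F.smul_mem (2 : ℝ) hw
  have s1 := triangleValue_split hμ hF hs hv2 hw2 h0 (p := v + w)
    ⟨1 / 2, 1 / 2, by norm_num, by norm_num, by norm_num, by module⟩
  have s2 := triangleValue_split hμ hF hs h0 hv2 hvw (p := v)
    ⟨1 / 2, 1 / 2, by norm_num, by norm_num, by norm_num, by module⟩
  have s3 := triangleValue_split hμ hF hs h0 hw2 hvw (p := w)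
    ⟨1 / 2, 1 / 2, by norm_num, by norm_num, by norm_num, by module⟩
  have t1 := triangleValue_add ht 0 v w v
  have t2 := triangleValue_add ht 0 v w w
  have e1 : v + v = (2 : ℝ) • v := by module
  have e2 : w + w = (2 : ℝ) • w := by module
  rw [zero_add, e1, add_comm w] at t1
  rw [zero_add, e2, triangleValue_swap_right] at t2
  have hflip := triangleValue_flip hμ hF hs ht hv hw
  rw [t1] at s2
  rw [t2] at s3
  rw [triangleValue_rotate, s1, triangleValue_rotate μ _ _ 0, triangleValue_rotate μ _ 0,
    triangleValue_rotate μ _ _ 0, triangleValue_swap μ _ 0, s2, s3]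
  linarith

include hμ hF hs ht in
theorem triangleValue_neg
    (hh : ∀ (K : ConvexBody V) (t : ℝ), 0 < t → μ (t • K) = t ^ 2 * μ K)
    {v w : V} (hv : v ∈ F) (hw : w ∈ F) :
    triangleValue μ 0 (-v) (-w) = triangleValue μ 0 v w := by
  have h1 := triangleValue_two_smul hμ hF hs ht hv hw
  have h2 := triangleValue_smul hh 0 v w (t := 2) (by norm_num)
  rw [smul_zero] at h2
  linarith

include hμ hF hs ht in
theorem triangleValue_shear
    (hh : ∀ (K : ConvexBody V) (t : ℝ), 0 < t → μ (t • K) = t ^ 2 * μ K)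
    {v w : V} (hv : v ∈ F) (hw : w ∈ F) :
    triangleValue μ 0 v (v + w) = triangleValue μ 0 v w := by
  have h1 := triangleValue_flip hμ hF hs ht hv hw
  have h2 := triangleValue_neg hμ hF hs ht hh hv hw
  have h3 := triangleValue_neg hμ hF hs ht hh hv (F.add_mem hv hw)
  have h4 := triangleValue_add ht 0 w (v + w) (-(v + w))
  have e : w + -(v + w) = -v := by abel
  rw [zero_add, e, add_neg_cancel, triangleValue_rotate, triangleValue_rotate, triangleValue_swap_right, h3] at h4
  linarith

include hμ hF hs ht in
theorem triangleValue_two_smul_left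
    (hh : ∀ (K : ConvexBody V) (t : ℝ), 0 < t → μ (t • K) = t ^ 2 * μ K)
    {v w : V} (hv : v ∈ F) (hw : w ∈ F) :
    triangleValue μ 0 ((2 : ℝ) • v) w = 2 * triangleValue μ 0 v w := by
  have h1 := triangleValue_split hμ hF hs F.zero_mem (F.smul_mem (2 : ℝ) hv) hw (p := v)
    ⟨1 / 2, 1 / 2, by norm_num, by norm_num, by norm_num, by module⟩
  have h2 := triangleValue_add ht v ((2 : ℝ) • v) w (-v)
  have h3 := triangleValue_shear hμ hF hs ht hh hv (F.sub_mem hw hv)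
  have e : (2 : ℝ) • v + -v = v := by module
  rw [add_neg_cancel, e, ← sub_eq_add_neg] at h2
  rw [add_sub_cancel] at h3
  linarith

include hμ hF hs ht in
theorem triangleValue_stretch
    (hh : ∀ (K : ConvexBody V) (t : ℝ), 0 < t → μ (t • K) = t ^ 2 * μ K)
    {v w : V} (hv : v ∈ F) (hw : w ∈ F) :
    triangleValue μ 0 ((2 : ℝ) • v) ((1 / 2 : ℝ) • w) = triangleValue μ 0 v w := by
  have h1 := triangleValue_two_smul_left hμ hF hs ht hh hv hw
  have h2 := triangleValue_two_smul_left hμ hF hs ht hh (F.smul_mem (1 / 2 : ℝ) hw)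
    (F.smul_mem (2 : ℝ) hv)
  have e : (2 : ℝ) • (1 / 2 : ℝ) • w = w := by module
  rw [e, triangleValue_swap_right, triangleValue_swap_right μ 0 _ ((2 : ℝ) • v)] at h2
  linarith

include hμ hF hs ht in
theorem eq_zero_of_triangleValue_eq_zero (hc : Continuous μ)
    (h : ∀ v ∈ F, ∀ w ∈ F, triangleValue μ 0 v w = 0) (K : ConvexBody V) (hK : (K : Set V) ⊆ F) :
    μ K = 0 := by
  refine eq_zero_of_simplices hc hμ hs (fun S hSF hSfin hScard => ?_) K hK
  rcases S.eq_empty_or_nonempty with rfl | hne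
  · simp [extendByZero]
  obtain ⟨g, rfl⟩ := Set.Finite.exists_range_eq hSfin hne (n := 3) (by omega)
  have hgF : ∀ j, g j ∈ F := fun j => hSF (Set.mem_range_self j)
  have hrange : Set.range g = {g 0, g 1, g 2} := by
    ext; simp [Fin.exists_fin_succ, eq_comm]
  have h1 := triangleValue_add ht (g 0) (g 1) (g 2) (-g 0)
  rw [hrange]
  change triangleValue μ (g 0) (g 1) (g 2) = 0
  rw [← h1, add_neg_cancel]
  exact h _ (F.add_mem (hgF 1) (F.neg_mem (hgF 0))) _ (F.add_mem (hgF 2) (F.neg_mem (hgF 0)))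

end Plane

/-- In degree at least three, a translation invariant continuous valuation vanishes on bodies of
dimension at most two. -/
theorem eq_zero_of_subset_finrank_le_two [FiniteDimensional ℝ V] {μ : ConvexBody V → ℝ}
    (hc : Continuous μ) (hμ : IsValuation μ) (ht : IsTranslationInvariant μ) {i : ℕ} (hi : 3 ≤ i)
    (hh : ∀ (K : ConvexBody V) (t : ℝ), 0 < t → μ (t • K) = t ^ i * μ K)
    (F : Submodule ℝ V) (hF : finrank ℝ F ≤ 2) (K : ConvexBody V) (hK : (K : Set V) ⊆ F) :
    μ K = 0 := by
  have hlow := eq_zero_of_subset_finrank_le_one hc hμ ht (by omega : 2 ≤ i) hh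
  rcases Nat.lt_or_ge (finrank ℝ F) 2 with h | h
  · exact hlow F (by omega) K hK
  have hF2 : finrank ℝ F = 2 := le_antisymm hF h
  have hs : IsSimpleOn μ F := isSimpleOn_of_forall_finrank_lt ht fun G hG K hK =>
    hlow G (by omega) K hK
  refine eq_zero_of_triangleValue_eq_zero hμ hF2 hs ht hc (fun v hv w hw => ?_) K hK
  have h1 := triangleValue_two_smul hμ hF2 hs ht hv hw
  have h2 := triangleValue_two_smul hμ hF2 hs ht (F.neg_mem hv) (F.neg_mem hw)
  have h3 := triangleValue_smul hh 0 v w (t := 2) (by norm_num)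
  have h4 := triangleValue_smul hh 0 (-v) (-w) (t := 2) (by norm_num)
  rw [smul_zero] at h3 h4
  rw [neg_neg, neg_neg] at h2
  have hpow : (8 : ℝ) ≤ 2 ^ i := by
    calc (8 : ℝ) = 2 ^ 3 := by norm_num
      _ ≤ 2 ^ i := pow_le_pow_right₀ (by norm_num) hi
  set x := triangleValue μ 0 v w
  set y := triangleValue μ 0 (-v) (-w)
  have h5 : (2 ^ i - 4) * (x + y) = 0 := by linarith
  have h6 : (2 ^ i - 2) * (x - y) = 0 := by linarith
  have h7 := (mul_eq_zero.1 h5).resolve_left (by linarith)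
  have h8 := (mul_eq_zero.1 h6).resolve_left (by linarith)
  linarith

end LowDimension

section SpecialLinear

variable {W : Type*} [NormedAddCommGroup W] [NormedSpace ℂ W] [FiniteDimensional ℂ W]

theorem exists_sl_equiv_of_matrix (b : Basis (Fin 2) ℂ W) (M : Matrix (Fin 2) (Fin 2) ℂ)
    (hM : M.det = 1) :
    ∃ g : W ≃L[ℂ] W, LinearMap.det ((g : W →L[ℂ] W) : W →ₗ[ℂ] W) = 1 ∧
      ∀ j, g (b j) = M 0 j • b 0 + M 1 j • b 1 := by
  have hdet : LinearMap.det (Matrix.toLin b b M) = 1 := by rw [LinearMap.det_toLin, hM]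
  let g₀ : W ≃ₗ[ℂ] W := LinearMap.equivOfDetNeZero (Matrix.toLin b b M) (by simp [hdet])
  have hg₀ : ∀ x, g₀ x = Matrix.toLin b b M x := fun x => rfl
  refine ⟨g₀.toContinuousLinearEquiv, ?_, fun j => ?_⟩
  · rw [← hdet]
    rfl
  · change g₀ (b j) = _
    rw [hg₀, Matrix.toLin_self, Fin.sum_univ_two]

/-- The transformation `diag(a, a⁻¹)` with respect to a basis. -/
theorem exists_sl_equiv_diag (b : Basis (Fin 2) ℂ W) {a : ℂ} (ha : a ≠ 0) :
    ∃ g : W ≃L[ℂ] W, LinearMap.det ((g : W →L[ℂ] W) : W →ₗ[ℂ] W) = 1 ∧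
      g (b 0) = a • b 0 ∧ g (b 1) = a⁻¹ • b 1 := by
  obtain ⟨g, hg, h⟩ := exists_sl_equiv_of_matrix b !![a, 0; 0, a⁻¹]
    (by simp [Matrix.det_fin_two, ha])
  exact ⟨g, hg, by simp [h], by simp [h]⟩

theorem exists_sl_equiv_shear (b : Basis (Fin 2) ℂ W) (c : ℂ) :
    ∃ g : W ≃L[ℂ] W, LinearMap.det ((g : W →L[ℂ] W) : W →ₗ[ℂ] W) = 1 ∧
      g (b 0) = b 0 ∧ g (b 1) = c • b 0 + b 1 := by
  obtain ⟨g, hg, h⟩ := exists_sl_equiv_of_matrix b !![1, c; 0, 1] (by simp [Matrix.det_fin_two])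
  exact ⟨g, hg, by simp [h], by simp [h]⟩

omit [FiniteDimensional ℂ W] in
theorem exists_basis_fst_eq (hW : finrank ℂ W = 2) {v : W} (hv : v ≠ 0) :
    ∃ b : Basis (Fin 2) ℂ W, b 0 = v := by
  have hne : ∃ w : W, w ∉ Submodule.span ℂ {v} := by
    by_contra! h
    have h1 : Submodule.span ℂ {v} = ⊤ := eq_top_iff.2 fun x _ => h x
    have h2 := finrank_span_singleton (K := ℂ) hv
    rw [h1, finrank_top] at h2
    omega
  obtain ⟨w, hw⟩ := hne
  have hli : LinearIndependent ℂ ![v, w] := by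
    rw [LinearIndependent.pair_iff' hv]
    rintro a rfl
    exact hw (Submodule.smul_mem _ _ (Submodule.mem_span_singleton_self v))
  exact ⟨basisOfLinearIndependentOfCardEqFinrank hli (by simp [hW]), by simp⟩

variable {Z : ConvexBody W → ConvexBody (W →L[ℂ] ℂ)} {f : ℕ → ConvexBody W → W → ℝ}

omit [FiniteDimensional ℂ W] in
theorem component_eq_zero_of_basis (hf : McMullenProps f)
    (hsum : ∀ (K : ConvexBody W) (u : W),
      hSupp (Z K) (fun ξ => (ξ u).re) = ∑ i ∈ Finset.range 5, f i K u)
    (b : Basis (Fin 2) ℂ W) (K : ConvexBody W) (h3 : ∀ u, f 3 K u = 0) (h4 : ∀ u, f 4 K u = 0)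
    (h0 : ∀ z : ℂ, f 2 K (z • b 0) = 0) (h1 : ∀ z : ℂ, f 2 K (z • b 1) = 0) (u : W) :
    f 2 K u = 0 := by
  have hle : ∀ u v : W, f 2 K (u + v) ≤ f 2 K u + f 2 K v := fun u v =>
    component_add_le hf hsum (by norm_num) K u v fun i hi hi' => by
      interval_cases i <;> simp [h3, h4]
  have hu : u = b.repr u 0 • b 0 + b.repr u 1 • b 1 := by
    rw [← Fin.sum_univ_two (fun i => b.repr u i • b i), b.sum_repr]
  set x := b.repr u 0
  set y := b.repr u 1
  have hle' : ∀ y : ℂ, f 2 K (x • b 0 + y • b 1) ≤ 0 := fun y =>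
    (hle _ _).trans (by rw [h0, h1, add_zero])
  have h2 := hle (x • b 0 + y • b 1) (x • b 0 + (-y) • b 1)
  have e : x • b 0 + y • b 1 + (x • b 0 + (-y) • b 1) = (2 * x) • b 0 := by module
  rw [e, h0] at h2
  rw [hu]
  linarith [hle' y, hle' (-y)]

theorem component_eq_zero_of_diag (hZg : IsSLContravariant Z)
    (hf : McMullenProps f)
    (hsum : ∀ (K : ConvexBody W) (u : W),
      hSupp (Z K) (fun ξ => (ξ u).re) = ∑ i ∈ Finset.range 5, f i K u)
    (b : Basis (Fin 2) ℂ W) (K : ConvexBody W) (h3 : ∀ u, f 3 K u = 0) (h4 : ∀ u, f 4 K u = 0)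
    {κ : ℝ} (hκ : 1 ≤ κ) (hκ' : κ ≠ 2)
    (hK : ∀ g : W ≃L[ℂ] W, g (b 0) = (2 : ℂ) • b 0 → g (b 1) = (2 : ℂ)⁻¹ • b 1 → ∀ u,
      f 2 (K.mapCLM (cReal (g : W →ₗ[ℂ] W))) u = κ * f 2 K u) (u : W) :
    f 2 K u = 0 := by
  obtain ⟨g, hg, hg0, hg1⟩ := exists_sl_equiv_diag b (a := 2) (by norm_num)
  have key : ∀ u, κ * f 2 K u = f 2 K (g.symm u) := fun u => by
    rw [← hK g hg0 hg1, component_mapCLM hZg hf hsum g hg (by norm_num)]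
  refine component_eq_zero_of_basis hf hsum b K h3 h4 (fun z => ?_) (fun z => ?_) u
  · have h1 : g.symm (z • b 0) = (1 / 2 : ℝ) • z • b 0 := by
      rw [ContinuousLinearEquiv.symm_apply_eq, ← Complex.coe_smul, map_smul, map_smul, hg0]
      simp only [smul_smul]
      congr 1; push_cast; ring
    have h2 := key (z • b 0)
    rw [h1, hf.2.2.2.2.2 _ _ _ _ (by norm_num)] at h2
    have : (κ - 1 / 2) * f 2 K (z • b 0) = 0 := by linarith
    exact (mul_eq_zero.1 this).resolve_left (by linarith)
  · have h1 : g.symm (z • b 1) = (2 : ℝ) • z • b 1 := by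
      rw [ContinuousLinearEquiv.symm_apply_eq, ← Complex.coe_smul, map_smul, map_smul, hg1]
      simp only [smul_smul]
      congr 1; push_cast; ring
    have h2 := key (z • b 1)
    rw [h1, hf.2.2.2.2.2 _ _ _ _ (by norm_num)] at h2
    have : (κ - 2) * f 2 K (z • b 1) = 0 := by linarith
    exact (mul_eq_zero.1 this).resolve_left (sub_ne_zero.2 hκ')

/-- The components of degree `2`, `3` and `4` vanish on bodies of real dimension at most two. -/
theorem component_eq_zero_of_finrank_le_two (hW : finrank ℂ W = 2) (hZg : IsSLContravariant Z)
    (hf : McMullenProps f)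
    (hsum : ∀ (K : ConvexBody W) (u : W),
      hSupp (Z K) (fun ξ => (ξ u).re) = ∑ i ∈ Finset.range 5, f i K u)
    {i : ℕ} (hi : 2 ≤ i) (F : Submodule ℝ W) (hF : finrank ℝ F ≤ 2) (K : ConvexBody W)
    (hK : (K : Set W) ⊆ F) (u : W) : f i K u = 0 := by
  have : FiniteDimensional ℝ W := FiniteDimensional.complexToReal W
  obtain ⟨hc, hv, ht, hh, -, -⟩ := id hf
  have hhigh : ∀ i, 3 ≤ i → ∀ (F : Submodule ℝ W), finrank ℝ F ≤ 2 → ∀ K : ConvexBody W,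
      (K : Set W) ⊆ F → ∀ u, f i K u = 0 := fun i hi F hF K hK u =>
    eq_zero_of_subset_finrank_le_two (hc i u) (hv i u) (ht i u) hi (fun K t => hh i K u t)
      F hF K hK
  rcases hi.eq_or_lt with rfl | hi
  swap
  · exact hhigh i hi F hF K hK u
  have hlow : ∀ (F : Submodule ℝ W), finrank ℝ F ≤ 1 → ∀ K : ConvexBody W,
      (K : Set W) ⊆ F → ∀ u, f 2 K u = 0 := fun F hF K hK u =>
    eq_zero_of_subset_finrank_le_one (hc 2 u) (hv 2 u) (ht 2 u) le_rfl (fun K t => hh 2 K u t)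
      F hF K hK
  rcases Nat.lt_or_ge (finrank ℝ F) 2 with h | h
  · exact hlow F (by omega) K hK u
  have hF2 : finrank ℝ F = 2 := le_antisymm hF h
  have hs : ∀ u, IsSimpleOn (fun K => f 2 K u) F := fun u =>
    isSimpleOn_of_forall_finrank_lt (ht 2 u) fun G hG K hK => hlow G (by omega) K hK u
  refine eq_zero_of_triangleValue_eq_zero (hv 2 u) hF2 (hs u) (ht 2 u) (hc 2 u)
    (fun v hvF w hwF => ?_) K hK
  let T : W → W → ConvexBody W := fun v w => ⟨convexHull ℝ {0, v, w}, convex_convexHull ℝ _,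
    (Set.toFinite _).isCompact_convexHull ℝ, ⟨0, subset_convexHull ℝ _ (by simp)⟩⟩
  have hT : ∀ u v w, triangleValue (fun K => f 2 K u) 0 v w = f 2 (T v w) u := fun u v w =>
    extendByZero_eq _ (T v w) rfl
  have hTF : (T v w : Set W) ⊆ F := convexHull_min
    (Set.insert_subset F.zero_mem (Set.insert_subset hvF (by simpa using hwF))) F.convex
  have hTmap : ∀ g : W ≃L[ℂ] W, (T v w).mapCLM (cReal (g : W →ₗ[ℂ] W)) = T (g v) (g w) := by
    intro g
    apply SetLike.coe_injective
    change cReal (g : W →ₗ[ℂ] W) '' convexHull ℝ {0, v, w} = convexHull ℝ {0, g v, g w}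
    rw [← ContinuousLinearMap.coe_coe, LinearMap.image_convexHull]
    simp [Set.image_insert_eq, cReal]
  rw [hT]
  by_cases hv0 : v = 0
  · refine hlow (Submodule.span ℝ {w}) ((finrank_span_le_card ({w} : Set W)).trans (by simp)) _ ?_ u
    refine convexHull_min ?_ (Submodule.convex _)
    rintro x (rfl | rfl | rfl)
    · exact Submodule.zero_mem _
    · rw [hv0]; exact Submodule.zero_mem _
    · exact Submodule.mem_span_singleton_self _
  by_cases hli : LinearIndependent ℂ ![v, w]
  · set b : Basis (Fin 2) ℂ W := basisOfLinearIndependentOfCardEqFinrank hli (by simp [hW]) with hb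
    have hb0 : b 0 = v := by simp [hb]
    have hb1 : b 1 = w := by simp [hb]
    refine component_eq_zero_of_diag hZg hf hsum b (T v w) (hhigh 3 le_rfl F hF _ hTF)
      (hhigh 4 (by norm_num) F hF _ hTF) (κ := 1) le_rfl (by norm_num) (fun g h0 h1 u => ?_) u
    rw [hb0] at h0
    rw [hb1] at h1
    have e0 : g v = (2 : ℝ) • v := by rw [h0, ← Complex.coe_smul]; norm_num
    have e1 : g w = (1 / 2 : ℝ) • w := by rw [h1, ← Complex.coe_smul]; norm_num
    rw [hTmap, one_mul, ← hT, ← hT, e0, e1]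
    exact triangleValue_stretch (hv 2 u) hF2 (hs u) (ht 2 u) (fun K t => hh 2 K u t) hvF hwF
  · obtain ⟨c, hcw⟩ : ∃ c : ℂ, w = c • v := by
      rw [LinearIndependent.pair_iff' hv0] at hli
      push Not at hli
      obtain ⟨c, hc⟩ := hli
      exact ⟨c, hc.symm⟩
    obtain ⟨b, hb⟩ := exists_basis_fst_eq hW hv0
    refine component_eq_zero_of_diag hZg hf hsum b (T v w) (hhigh 3 le_rfl F hF _ hTF)
      (hhigh 4 (by norm_num) F hF _ hTF) (κ := 4) (by norm_num) (by norm_num)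
      (fun g h0 h1 u => ?_) u
    rw [hb] at h0
    have e0 : g v = (2 : ℝ) • v := by rw [h0, ← Complex.coe_smul]; norm_num
    have e1 : g w = (2 : ℝ) • w := by rw [hcw, map_smul, e0, smul_comm]
    have := triangleValue_smul (μ := fun K => f 2 K u) (fun K t => hh 2 K u t) 0 v w (t := 2) (by norm_num)
    rw [smul_zero, hT, hT] at this
    rw [hTmap, e0, e1, this]
    norm_num

end SpecialLinear

section Tetrahedra

variable {V : Type*} [NormedAddCommGroup V] [NormedSpace ℝ V]

/-- The value of a functional on the tetrahedron with the given vertices. -/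
def tetraValue (μ : ConvexBody V → ℝ) (a b c d : V) : ℝ :=
  extendByZero μ (convexHull ℝ {a, b, c, d})

theorem tetraValue_swap (μ : ConvexBody V → ℝ) (a b c d : V) :
    tetraValue μ a b c d = tetraValue μ b a c d := by
  unfold tetraValue; rw [Set.insert_comm]

theorem tetraValue_swap_middle (μ : ConvexBody V → ℝ) (a b c d : V) :
    tetraValue μ a b c d = tetraValue μ a c b d := by
  unfold tetraValue; rw [Set.insert_comm b c]

theorem tetraValue_swap_right (μ : ConvexBody V → ℝ) (a b c d : V) :
    tetraValue μ a b c d = tetraValue μ a b d c := by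
  unfold tetraValue; rw [Set.pair_comm]

theorem tetraValue_swap_pairs (μ : ConvexBody V → ℝ) (a b c d : V) :
    tetraValue μ a b c d = tetraValue μ c d a b := by
  rw [tetraValue_swap_middle, tetraValue_swap, tetraValue_swap_right, tetraValue_swap_middle]

/-- A valuation which is simple on the subspace `F` and invariant under translations and under
the shears of `F` along the kernel of the functional `h`, and which is multiplied by `σ` under the
dilation by two, and by `ρ` under the dilation by two of the kernel of `h` fixing `e`. -/
structure IsShearInvariantOn (μ : ConvexBody V → ℝ) (F : Submodule ℝ V) (h : V →L[ℝ] ℝ) (e : V)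
    (σ ρ : ℝ) : Prop where
  isValuation : IsValuation μ
  isSimpleOn : IsSimpleOn μ F
  translate : IsTranslationInvariant μ
  mem : e ∈ F
  apply_eq_one : h e = 1
  shear : ∀ c ∈ F, h c = 0 → ∀ K K' : ConvexBody V, (K : Set V) ⊆ F →
    (K' : Set V) = (fun y => y + h y • c) '' K → μ K' = μ K
  smul : ∀ K : ConvexBody V, (K : Set V) ⊆ F → μ ((2 : ℝ) • K) = σ * μ K
  dilate : ∀ K K' : ConvexBody V, (K : Set V) ⊆ F →
    (K' : Set V) = (fun y => (2 : ℝ) • y - h y • e) '' K → μ K' = ρ * μ K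

namespace IsShearInvariantOn

variable {μ : ConvexBody V → ℝ} {F : Submodule ℝ V} {h : V →L[ℝ] ℝ} {e : V} {σ ρ : ℝ}

theorem tetraValue_shear (H : IsShearInvariantOn μ F h e σ ρ) {a b c d v x : V} (ha : a ∈ F)
    (hb : b ∈ F) (hc : c ∈ F) (hd : d ∈ F) (hv : v ∈ F) (hv0 : h v = 0) :
    tetraValue μ (a + h a • v + x) (b + h b • v + x) (c + h c • v + x) (d + h d • v + x) =
      tetraValue μ a b c d := by
  have := extendByZero_convexHull_image (μ := μ) (ν := μ) F.convex
    (ContinuousLinearMap.id ℝ V + h.smulRight v) x 1 (fun K K' hKF hK => ?_) (S := {a, b, c, d})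
    (by simp) (by rintro y (rfl | rfl | rfl | rfl) <;> assumption)
  · simpa [tetraValue, Set.image_insert_eq] using this
  · rw [one_mul]
    set M : ConvexBody V := K.mapCLM (ContinuousLinearMap.id ℝ V + h.smulRight v)
    rw [← H.shear v hv hv0 K M hKF (Set.image_congr fun y _ => by simp), ← H.translate M x]
    congr 1
    apply SetLike.coe_injective
    rw [hK]
    change _ = (fun y => x + y) '' ((ContinuousLinearMap.id ℝ V + h.smulRight v) '' (K : Set V))
    rw [Set.image_image]
    exact Set.image_congr fun y _ => add_comm _ _

theorem tetraValue_smul (H : IsShearInvariantOn μ F h e σ ρ) {a b c d : V} (ha : a ∈ F)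
    (hb : b ∈ F) (hc : c ∈ F) (hd : d ∈ F) :
    tetraValue μ ((2 : ℝ) • a) ((2 : ℝ) • b) ((2 : ℝ) • c) ((2 : ℝ) • d) =
      σ * tetraValue μ a b c d := by
  have := extendByZero_convexHull_image (μ := μ) (ν := μ) F.convex
    ((2 : ℝ) • ContinuousLinearMap.id ℝ V) 0 σ (fun K K' hKF hK => ?_) (S := {a, b, c, d})
    (by simp) (by rintro y (rfl | rfl | rfl | rfl) <;> assumption)
  · simpa [tetraValue, Set.image_insert_eq] using this
  · rw [← H.smul K hKF]
    congr 1
    apply SetLike.coe_injective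
    rw [hK, ConvexBody.coe_smul]
    exact Set.image_congr fun y _ => by simp

theorem tetraValue_dilate (H : IsShearInvariantOn μ F h e σ ρ) {a b c d : V} (ha : a ∈ F)
    (hb : b ∈ F) (hc : c ∈ F) (hd : d ∈ F) :
    tetraValue μ ((2 : ℝ) • a - h a • e) ((2 : ℝ) • b - h b • e) ((2 : ℝ) • c - h c • e)
      ((2 : ℝ) • d - h d • e) = ρ * tetraValue μ a b c d := by
  have := extendByZero_convexHull_image (μ := μ) (ν := μ) F.convex
    ((2 : ℝ) • ContinuousLinearMap.id ℝ V - h.smulRight e) 0 ρ (fun K K' hKF hK => ?_)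
    (S := {a, b, c, d}) (by simp) (by rintro y (rfl | rfl | rfl | rfl) <;> assumption)
  · simpa [tetraValue, Set.image_insert_eq] using this
  · refine H.dilate K K' hKF ?_
    rw [hK]
    exact Set.image_congr fun y _ => by simp

theorem tetraValue_eq_zero_of_const (H : IsShearInvariantOn μ F h e σ ρ) {a b c d : V}
    (ha : a ∈ F) (hb : b ∈ F) (hc : c ∈ F) (hd : d ∈ F) (hab : h a = h b) (hac : h a = h c)
    (had : h a = h d) : tetraValue μ a b c d = 0 := by
  refine H.isSimpleOn.extendByZero (convexHull_min ?_ F.convex) h (h a)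
    ⟨e, H.mem, by simp [H.apply_eq_one]⟩ fun x hx => ?_
  · rintro y (rfl | rfl | rfl | rfl) <;> assumption
  · refine convexHull_min (t := {x | h x = h a}) ?_ (convex_hyperplane h.isLinear _) hx
    rintro y (rfl | rfl | rfl | rfl) <;> simp_all

variable [FiniteDimensional ℝ V]

theorem tetraValue_split (H : IsShearInvariantOn μ F h e σ ρ) (hF : finrank ℝ F = 3)
    {a b c d p : V} (ha : a ∈ F) (hb : b ∈ F) (hc : c ∈ F) (hd : d ∈ F)
    (hp : p ∈ segment ℝ a b) :
    tetraValue μ a b c d = tetraValue μ a p c d + tetraValue μ p b c d := by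
  refine extendByZero_split H.isValuation H.isSimpleOn ha hb (R := {c, d}) ?_ (by simp) ?_ hp
  · rintro y (rfl | rfl) <;> assumption
  · have := Set.ncard_insert_le c {d}
    rw [Set.ncard_singleton] at this
    omega

omit [FiniteDimensional ℝ V] in
/-- Shifting the points at height `s` by `p` and those at height `t` by `q`. -/
theorem tetraValue_shift (H : IsShearInvariantOn μ F h e σ ρ) {a b c d p q : V} {s t : ℝ}
    (hst : s ≠ t) (ha : a ∈ F) (hb : b ∈ F) (hc : c ∈ F) (hd : d ∈ F) (hp : p ∈ F) (hq : q ∈ F)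
    (hpq : h p = h q) {a' b' c' d' : V}
    (ha' : h a = s ∧ a' = a + p ∨ h a = t ∧ a' = a + q)
    (hb' : h b = s ∧ b' = b + p ∨ h b = t ∧ b' = b + q)
    (hc' : h c = s ∧ c' = c + p ∨ h c = t ∧ c' = c + q)
    (hd' : h d = s ∧ d' = d + p ∨ h d = t ∧ d' = d + q) :
    tetraValue μ a' b' c' d' = tetraValue μ a b c d := by
  have hne : s - t ≠ 0 := sub_ne_zero.2 hst
  set v : V := (s - t)⁻¹ • (p - q) with hv
  have hvF : v ∈ F := F.smul_mem _ (F.sub_mem hp hq)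
  have hv0 : h v = 0 := by simp [hv, hpq]
  have hsv : s • v - t • v = p - q := by
    rw [← sub_smul, hv, smul_smul, mul_inv_cancel₀ hne, one_smul]
  have key : ∀ y y' : V, (h y = s ∧ y' = y + p ∨ h y = t ∧ y' = y + q) →
      y' = y + h y • v + (p - s • v) := by
    rintro y y' (⟨h1, rfl⟩ | ⟨h1, rfl⟩)
    · rw [h1]; abel
    · rw [h1]
      have : p - s • v = q - t • v := by
        rw [sub_eq_sub_iff_sub_eq_sub, ← hsv]
      rw [this]; abel
  rw [key a a' ha', key b b' hb', key c c' hc', key d d' hd']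
  exact H.tetraValue_shear ha hb hc hd hvF hv0

theorem tetraValue_eq_zero_of_pairs (H : IsShearInvariantOn μ F h e σ ρ) (hF : finrank ℝ F = 3)
    (hρ : ρ ≠ 4) {a b x y : V} (ha : a ∈ F) (hb : b ∈ F) (hx : x ∈ F) (hy : y ∈ F)
    (hab : h a = h b) (hxy : h x = h y) : tetraValue μ a b x y = 0 := by
  by_cases hne : h a = h x
  · exact H.tetraValue_eq_zero_of_const ha hb hx hy hab hne (hne.trans hxy)
  have hhalf : ∀ {a b x y : V}, a ∈ F → b ∈ F → x ∈ F → y ∈ F → h a = h b → h x = h y →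
      h a ≠ h x → tetraValue μ a b x y =
        2 * tetraValue μ a ((1 / 2 : ℝ) • a + (1 / 2 : ℝ) • b) x y := by
    intro a b x y ha hb hx hy hab hxy hne
    rw [H.tetraValue_split hF ha hb hx hy
      (p := (1 / 2 : ℝ) • a + (1 / 2 : ℝ) • b)
      ⟨1 / 2, 1 / 2, by norm_num, by norm_num, by norm_num, rfl⟩, two_mul]
    congr 1
    have hm : (1 / 2 : ℝ) • a + (1 / 2 : ℝ) • b ∈ F :=
      F.add_mem (F.smul_mem _ ha) (F.smul_mem _ hb)
    refine H.tetraValue_shift hne ha hm hx hy (p := (1 / 2 : ℝ) • (b - a)) (q := 0)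
      (F.smul_mem _ (F.sub_mem hb ha)) F.zero_mem (by simp [hab])
      (Or.inl ⟨rfl, by module⟩) (Or.inl ⟨?_, by module⟩) (Or.inr ⟨rfl, by simp⟩)
      (Or.inr ⟨hxy.symm, by simp⟩)
    simp only [map_add, map_smul, smul_eq_mul, ← hab]; ring
  set m : V := (1 / 2 : ℝ) • a + (1 / 2 : ℝ) • b with hm
  set n : V := (1 / 2 : ℝ) • x + (1 / 2 : ℝ) • y with hn
  have hmF : m ∈ F := F.add_mem (F.smul_mem _ ha) (F.smul_mem _ hb)
  have hnF : n ∈ F := F.add_mem (F.smul_mem _ hx) (F.smul_mem _ hy)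
  have hma : h m = h a := by
    simp only [hm, map_add, map_smul, smul_eq_mul, ← hab]; ring
  have hnx : h n = h x := by
    simp only [hn, map_add, map_smul, smul_eq_mul, ← hxy]; ring
  have h1 := hhalf ha hb hx hy hab hxy hne
  have h2 := hhalf hx hy ha hmF hxy hma.symm (Ne.symm hne)
  rw [tetraValue_swap_pairs, tetraValue_swap_pairs μ x] at h2
  have h3 := H.tetraValue_dilate ha hmF hx hnF
  have h4 := H.tetraValue_shift hne ha hb hx hy (p := a - h a • e) (q := x - h x • e)
    (F.sub_mem ha (F.smul_mem _ H.mem)) (F.sub_mem hx (F.smul_mem _ H.mem))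
    (by simp [H.apply_eq_one])
    (a' := (2 : ℝ) • a - h a • e) (b' := (2 : ℝ) • m - h m • e)
    (c' := (2 : ℝ) • x - h x • e) (d' := (2 : ℝ) • n - h n • e)
    (Or.inl ⟨rfl, by module⟩) (Or.inl ⟨hab.symm, by rw [hma, hm]; module⟩)
    (Or.inr ⟨rfl, by module⟩) (Or.inr ⟨hxy.symm, by rw [hnx, hn]; module⟩)
  have h5 : (4 - ρ) * tetraValue μ a m x n = 0 := by linarith
  have h6 := (mul_eq_zero.1 h5).resolve_left (sub_ne_zero.2 hρ.symm)
  rw [h1, h2, h6]; norm_num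

theorem tetraValue_eq_zero_of_base_aux (H : IsShearInvariantOn μ F h e σ ρ)
    (hF : finrank ℝ F = 3) (hρ : ρ ≠ 4) {v w : V} (hv : v ∈ F) (hw : w ∈ F) (hv0 : h v = 0)
    (hw0 : h w = 0) {η : ℝ} (hη : η ≠ 0) :
    σ * tetraValue μ 0 v w (η • e) = ρ * tetraValue μ 0 v w (η • e) +
      tetraValue μ 0 v w ((-η) • e) + tetraValue μ 0 v w (η • e) := by
  have h0 := F.zero_mem
  have hηe := F.smul_mem η H.mem
  have hηe2 := F.smul_mem (2 : ℝ) hηe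
  have hv2 := F.smul_mem (2 : ℝ) hv
  have hw2 := F.smul_mem (2 : ℝ) hw
  have hhe : h (η • e) = η := by simp [H.apply_eq_one]
  set p := v + η • e with hp
  set q := w + η • e with hq
  have hpF : p ∈ F := F.add_mem hv hηe
  have hqF : q ∈ F := F.add_mem hw hηe
  have hph : h p = η := by rw [hp, map_add, hv0, hhe, zero_add]
  have hqh : h q = η := by rw [hq, map_add, hw0, hhe, zero_add]
  have h1 := H.tetraValue_smul h0 hv hw hηe
  have h2 := H.tetraValue_dilate h0 hv hw hηe
  rw [smul_zero] at h1 h2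
  rw [map_zero, hv0, hw0, hhe, zero_smul, sub_zero, sub_zero, sub_zero] at h2
  have e1 : (2 : ℝ) • η • e - η • e = η • e := by module
  rw [e1] at h2
  have s1 := H.tetraValue_split hF h0 hηe2 hv2 hw2 (p := η • e)
    ⟨1 / 2, 1 / 2, by norm_num, by norm_num, by norm_num, by module⟩
  have s2 := H.tetraValue_split hF hv2 hηe2 hηe hw2 (p := p)
    ⟨1 / 2, 1 / 2, by norm_num, by norm_num, by norm_num, by rw [hp]; module⟩
  have s3 := H.tetraValue_split hF hw2 hηe2 hηe hpF (p := q)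
    ⟨1 / 2, 1 / 2, by norm_num, by norm_num, by norm_num, by rw [hq]; module⟩
  have z : tetraValue μ ((2 : ℝ) • v) p (η • e) ((2 : ℝ) • w) = 0 := by
    rw [tetraValue_swap_right, tetraValue_swap_middle]
    exact H.tetraValue_eq_zero_of_pairs hF hρ hv2 hw2 hpF hηe (by simp [hv0, hw0])
      (by rw [hph, hhe])
  have t1 : tetraValue μ (η • e) p q ((2 : ℝ) • w) = tetraValue μ 0 v w ((-η) • e) :=
    H.tetraValue_shift (s := 0) (t := -η) (neg_ne_zero.2 hη).symm h0 hv hw (F.smul_mem _ H.mem)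
      (p := η • e) (q := (2 : ℝ) • w + η • e) hηe (F.add_mem hw2 hηe) (by simp [hw0])
      (Or.inl ⟨map_zero h, by simp⟩) (Or.inl ⟨hv0, rfl⟩) (Or.inl ⟨hw0, rfl⟩)
      (Or.inr ⟨by simp [H.apply_eq_one], by module⟩)
  have t2 : tetraValue μ (η • e) p q ((2 : ℝ) • η • e) = tetraValue μ 0 v w (η • e) :=
    H.tetraValue_shift (s := 0) (t := η) hη.symm h0 hv hw hηe
      (p := η • e) (q := η • e) hηe hηe rfl
      (Or.inl ⟨map_zero h, by simp⟩) (Or.inl ⟨hv0, rfl⟩) (Or.inl ⟨hw0, rfl⟩)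
      (Or.inr ⟨hhe, by module⟩)
  have perm : ∀ {a b c d a' b' c' d' : V}, ({a, b, c, d} : Set V) = {a', b', c', d'} →
      tetraValue μ a b c d = tetraValue μ a' b' c' d' := fun h => by
    unfold tetraValue; rw [h]
  have p1 : tetraValue μ 0 ((2 : ℝ) • η • e) ((2 : ℝ) • v) ((2 : ℝ) • w) =
      tetraValue μ 0 ((2 : ℝ) • v) ((2 : ℝ) • w) ((2 : ℝ) • η • e) :=
    perm (by ext; simp only [Set.mem_insert_iff, Set.mem_singleton_iff]; tauto)
  have p2 : tetraValue μ 0 (η • e) ((2 : ℝ) • v) ((2 : ℝ) • w) =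
      tetraValue μ 0 ((2 : ℝ) • v) ((2 : ℝ) • w) (η • e) :=
    perm (by ext; simp only [Set.mem_insert_iff, Set.mem_singleton_iff]; tauto)
  have p3 : tetraValue μ (η • e) ((2 : ℝ) • η • e) ((2 : ℝ) • v) ((2 : ℝ) • w) =
      tetraValue μ ((2 : ℝ) • v) ((2 : ℝ) • η • e) (η • e) ((2 : ℝ) • w) :=
    perm (by ext; simp only [Set.mem_insert_iff, Set.mem_singleton_iff]; tauto)
  have p4 : tetraValue μ p ((2 : ℝ) • η • e) (η • e) ((2 : ℝ) • w) =
      tetraValue μ ((2 : ℝ) • w) ((2 : ℝ) • η • e) (η • e) p :=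
    perm (by ext; simp only [Set.mem_insert_iff, Set.mem_singleton_iff]; tauto)
  have p5 : tetraValue μ ((2 : ℝ) • w) q (η • e) p = tetraValue μ (η • e) p q ((2 : ℝ) • w) :=
    perm (by ext; simp only [Set.mem_insert_iff, Set.mem_singleton_iff]; tauto)
  have p6 : tetraValue μ q ((2 : ℝ) • η • e) (η • e) p =
      tetraValue μ (η • e) p q ((2 : ℝ) • η • e) :=
    perm (by ext; simp only [Set.mem_insert_iff, Set.mem_singleton_iff]; tauto)
  linarith

theorem tetraValue_eq_zero_of_base (H : IsShearInvariantOn μ F h e σ ρ) (hF : finrank ℝ F = 3)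
    (hρ : ρ ≠ 4) (hσ : (σ - ρ - 1) ^ 2 ≠ 1) {a b c d : V} (ha : a ∈ F) (hb : b ∈ F) (hc : c ∈ F)
    (hd : d ∈ F) (hab : h a = h b) (hac : h a = h c) : tetraValue μ a b c d = 0 := by
  by_cases had : h a = h d
  · exact H.tetraValue_eq_zero_of_const ha hb hc hd hab hac had
  set η := h d - h a with hη
  have hη0 : η ≠ 0 := sub_ne_zero.2 (Ne.symm had)
  have hv := F.sub_mem hb ha
  have hw := F.sub_mem hc ha
  have hv0 : h (b - a) = 0 := by simp [hab]
  have hw0 : h (c - a) = 0 := by simp [hac]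
  have h1 := H.tetraValue_eq_zero_of_base_aux hF hρ hv hw hv0 hw0 hη0
  have h2 := H.tetraValue_eq_zero_of_base_aux hF hρ hv hw hv0 hw0 (neg_ne_zero.2 hη0)
  rw [neg_neg] at h2
  have key : tetraValue μ a b c d = tetraValue μ 0 (b - a) (c - a) (η • e) :=
    H.tetraValue_shift (s := 0) (t := η) hη0.symm F.zero_mem hv hw (F.smul_mem _ H.mem)
      (p := a) (q := d - η • e) ha (F.sub_mem hd (F.smul_mem _ H.mem))
      (by simp [H.apply_eq_one, hη]) (Or.inl ⟨map_zero h, by simp⟩) (Or.inl ⟨hv0, by simp⟩)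
      (Or.inl ⟨hw0, by simp⟩) (Or.inr ⟨by simp [H.apply_eq_one], by simp⟩)
  rw [key]
  set x := tetraValue μ 0 (b - a) (c - a) (η • e)
  set y := tetraValue μ 0 (b - a) (c - a) ((-η) • e)
  have hy : y = (σ - ρ - 1) * x := by linarith
  have hx : ((σ - ρ - 1) ^ 2 - 1) * x = 0 := by rw [hy] at h2; linarith
  exact (mul_eq_zero.1 hx).resolve_left (sub_ne_zero.2 hσ)

theorem tetraValue_eq_zero_of_between (H : IsShearInvariantOn μ F h e σ ρ)
    (hF : finrank ℝ F = 3) (hρ : ρ ≠ 4) (hσ : (σ - ρ - 1) ^ 2 ≠ 1) {a b c d : V} (ha : a ∈ F)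
    (hb : b ∈ F) (hc : c ∈ F) (hd : d ∈ F) (hab : h a = h b) (hca : h c ≤ h a) (had : h a ≤ h d) :
    tetraValue μ a b c d = 0 := by
  obtain ⟨p, hp, hpa⟩ := exists_mem_segment_eq h had hca
  have hpF : p ∈ F := F.convex.segment_subset hd hc hp
  rw [tetraValue_swap_right, tetraValue_swap_pairs, H.tetraValue_split hF hd hc ha hb hp,
    tetraValue_swap_pairs, tetraValue_swap_right, tetraValue_swap_pairs μ p,
    H.tetraValue_eq_zero_of_base hF hρ hσ ha hb hpF hd hab hpa.symm,
    H.tetraValue_eq_zero_of_base hF hρ hσ ha hb hpF hc hab hpa.symm, add_zero]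

theorem tetraValue_eq_zero_of_eq (H : IsShearInvariantOn μ F h e σ ρ)
    (hF : finrank ℝ F = 3) (hρ : ρ ≠ 4) (hσ : (σ - ρ - 1) ^ 2 ≠ 1) {a b c d : V} (ha : a ∈ F)
    (hb : b ∈ F) (hc : c ∈ F) (hd : d ∈ F) (hab : h a = h b) : tetraValue μ a b c d = 0 := by
  have side : ∀ {a b c d p : V}, a ∈ F → b ∈ F → c ∈ F → d ∈ F → h a = h b →
      p ∈ segment ℝ a d → h p = h c →
      (h b ≤ h p ∧ h p ≤ h d ∨ h d ≤ h p ∧ h p ≤ h b) → tetraValue μ a b c d = 0 := by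
    intro a b c d p ha hb hc hd hab hp hpc hbet
    have hpF : p ∈ F := F.convex.segment_subset ha hd hp
    rw [tetraValue_swap_right, tetraValue_swap_middle, H.tetraValue_split hF ha hd hb hc hp,
      tetraValue_swap_middle, H.tetraValue_eq_zero_of_pairs hF hρ ha hb hpF hc hab hpc, zero_add,
      tetraValue_swap_right, tetraValue_swap_middle, tetraValue_swap_right]
    rcases hbet with ⟨h1, h2⟩ | ⟨h1, h2⟩
    · exact H.tetraValue_eq_zero_of_between hF hρ hσ hpF hc hb hd hpc h1 h2
    · rw [tetraValue_swap_right]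
      exact H.tetraValue_eq_zero_of_between hF hρ hσ hpF hc hd hb hpc h1 h2
  rcases le_total (h c) (h a) with h1 | h1 <;> rcases le_total (h d) (h a) with h2 | h2
  · rcases le_total (h c) (h d) with h3 | h3
    · obtain ⟨p, hp, hpd⟩ := exists_mem_segment_eq h h2 h3
      rw [tetraValue_swap_right]
      exact side ha hb hd hc hab hp hpd (Or.inr (by rw [hpd, ← hab]; exact ⟨h3, h2⟩))
    · obtain ⟨p, hp, hpd⟩ := exists_mem_segment_eq h h1 h3
      exact side ha hb hc hd hab hp hpd (Or.inr (by rw [hpd, ← hab]; exact ⟨h3, h1⟩))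
  · exact H.tetraValue_eq_zero_of_between hF hρ hσ ha hb hc hd hab h1 h2
  · rw [tetraValue_swap_right]
    exact H.tetraValue_eq_zero_of_between hF hρ hσ ha hb hd hc hab h2 h1
  · rcases le_total (h c) (h d) with h3 | h3
    · obtain ⟨p, hp, hpd⟩ := exists_mem_segment_eq h h3 h1
      rw [segment_symm] at hp
      exact side ha hb hc hd hab hp hpd (Or.inl (by rw [hpd, ← hab]; exact ⟨h1, h3⟩))
    · obtain ⟨p, hp, hpd⟩ := exists_mem_segment_eq h h3 h2
      rw [segment_symm] at hp
      rw [tetraValue_swap_right]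
      exact side ha hb hd hc hab hp hpd (Or.inl (by rw [hpd, ← hab]; exact ⟨h2, h3⟩))

theorem tetraValue_eq_zero (H : IsShearInvariantOn μ F h e σ ρ)
    (hF : finrank ℝ F = 3) (hρ : ρ ≠ 4) (hσ : (σ - ρ - 1) ^ 2 ≠ 1) {a b c d : V} (ha : a ∈ F)
    (hb : b ∈ F) (hc : c ∈ F) (hd : d ∈ F) : tetraValue μ a b c d = 0 := by
  have median : ∀ {a b c : V}, a ∈ F → b ∈ F → c ∈ F → h a ≤ h b → h b ≤ h c →
      tetraValue μ a b c d = 0 := by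
    intro a b c ha hb hc h1 h2
    obtain ⟨p, hp, hpb⟩ := exists_mem_segment_eq h h2 h1
    have hpF : p ∈ F := F.convex.segment_subset hc ha hp
    rw [tetraValue_swap_middle, tetraValue_swap, H.tetraValue_split hF hc ha hb hd hp,
      tetraValue_swap, tetraValue_swap_middle,
      H.tetraValue_eq_zero_of_eq hF hρ hσ hpF hb hc hd hpb, zero_add, tetraValue_swap_middle,
      H.tetraValue_eq_zero_of_eq hF hρ hσ hpF hb ha hd hpb]
  have swap := tetraValue_swap μ
  have swap' := tetraValue_swap_middle μ
  rcases le_total (h a) (h b) with h1 | h1 <;> rcases le_total (h b) (h c) with h2 | h2 <;>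
    rcases le_total (h a) (h c) with h3 | h3
  · exact median ha hb hc h1 h2
  · exact median ha hb hc h1 h2
  · rw [swap']; exact median ha hc hb h3 h2
  · rw [swap', swap]; exact median hc ha hb h3 h1
  · rw [swap]; exact median hb ha hc h1 h3
  · rw [swap, swap']; exact median hb hc ha h2 h3
  · rw [swap', swap, swap']; exact median hc hb ha h2 h1
  · rw [swap', swap, swap']; exact median hc hb ha h2 h1

theorem eq_zero (H : IsShearInvariantOn μ F h e σ ρ) (hcont : Continuous μ)
    (hF : finrank ℝ F = 3) (hρ : ρ ≠ 4) (hσ : (σ - ρ - 1) ^ 2 ≠ 1) (K : ConvexBody V)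
    (hK : (K : Set V) ⊆ F) : μ K = 0 := by
  refine eq_zero_of_simplices hcont H.isValuation H.isSimpleOn (fun S hSF hSfin hScard => ?_) K hK
  rcases S.eq_empty_or_nonempty with rfl | hne
  · simp [extendByZero]
  obtain ⟨g, rfl⟩ := Set.Finite.exists_range_eq hSfin hne (n := 4) (by omega)
  have hgF : ∀ j, g j ∈ F := fun j => hSF (Set.mem_range_self j)
  have hrange : Set.range g = {g 0, g 1, g 2, g 3} := by
    ext; simp [Fin.exists_fin_succ, eq_comm]
  rw [hrange]
  exact H.tetraValue_eq_zero hF hρ hσ (hgF 0) (hgF 1) (hgF 2) (hgF 3)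

end IsShearInvariantOn

end Tetrahedra

section ThreeDimensional

variable {W : Type*} [NormedAddCommGroup W] [NormedSpace ℂ W]

theorem mem_span_triple_iff (v w y : W) :
    y ∈ Submodule.span ℝ {v, Complex.I • v, w} ↔ ∃ (z : ℂ) (r : ℝ), y = z • v + r • w := by
  simp only [Submodule.mem_span_insert, Submodule.mem_span_singleton]
  constructor
  · rintro ⟨p, _, ⟨q, _, ⟨r, rfl⟩, rfl⟩, rfl⟩
    refine ⟨p + q * Complex.I, r, ?_⟩
    simp only [add_smul, mul_smul, Complex.coe_smul]
    abel
  · rintro ⟨z, r, rfl⟩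
    refine ⟨z.re, _, ⟨z.im, _, ⟨r, rfl⟩, rfl⟩, ?_⟩
    conv_lhs => rw [← Complex.re_add_im z]
    simp only [add_smul, mul_smul, Complex.coe_smul]
    abel

variable [FiniteDimensional ℂ W]

/-- The real part of the second coordinate with respect to a basis. -/
def reCoordOne (b : Basis (Fin 2) ℂ W) : W →L[ℝ] ℝ :=
  Complex.reCLM.comp
    (((b.coord 1).toContinuousLinearMap : W →L[ℂ] ℂ).restrictScalars ℝ)

theorem reCoordOne_apply (b : Basis (Fin 2) ℂ W) (z : ℂ) (r : ℝ) :
    reCoordOne b (z • b 0 + r • b 1) = r := by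
  simp [reCoordOne, ← Complex.coe_smul]

omit [FiniteDimensional ℂ W] in
theorem finrank_span_triple (b : Basis (Fin 2) ℂ W) :
    finrank ℝ (Submodule.span ℝ {b 0, Complex.I • b 0, b 1}) = 3 := by
  have hli : LinearIndependent ℝ ![b 0, Complex.I • b 0, b 1] := by
    rw [Fintype.linearIndependent_iff]
    intro g hg
    have h1 : ((g 0 : ℂ) + g 1 * Complex.I) • b 0 + (g 2 : ℂ) • b 1 = 0 := by
      rw [← hg]
      simp [Fin.sum_univ_three, add_smul, mul_smul]
    have h2 := congrArg (fun y => b.repr y 0) h1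
    have h3 := congrArg (fun y => b.repr y 1) h1
    simp only [map_add, map_smul, b.repr_self, Finsupp.add_apply, Finsupp.smul_apply] at h2 h3
    simp [Complex.ext_iff] at h2 h3
    intro i
    fin_cases i
    · exact h2.1
    · exact h2.2
    · exact h3
  have h := finrank_span_eq_card hli
  have hr : Set.range ![b 0, Complex.I • b 0, b 1] = {b 0, Complex.I • b 0, b 1} := by
    rw [Matrix.range_cons, Matrix.range_cons_cons_empty, Set.singleton_union]
  rwa [Fintype.card_fin, hr] at h

variable {Z : ConvexBody W → ConvexBody (W →L[ℂ] ℂ)} {f : ℕ → ConvexBody W → W → ℝ}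

theorem isShearInvariantOn_component (hZg : IsSLContravariant Z) (hf : McMullenProps f)
    (hsum : ∀ (K : ConvexBody W) (u : W),
      hSupp (Z K) (fun ξ => (ξ u).re) = ∑ i ∈ Finset.range 5, f i K u)
    (b : Basis (Fin 2) ℂ W) {i : ℕ} (hi : 2 ≤ i) (hi' : i < 5) {u : W} {κ : ℝ} (hκ : 0 < κ)
    (hshear : ∀ (g : W ≃L[ℂ] W) (β : ℂ), g (b 0) = b 0 → g (b 1) = β • b 0 + b 1 →
      ∀ K : ConvexBody W, (K : Set W) ⊆ Submodule.span ℝ {b 0, Complex.I • b 0, b 1} →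
        f i K (g.symm u) = f i K u)
    (hdiag : ∀ g : W ≃L[ℂ] W, g (b 0) = (√2 : ℂ) • b 0 → g (b 1) = (√2 : ℂ)⁻¹ • b 1 →
      g.symm u = κ • u) :
    IsShearInvariantOn (fun K => f i K u) (Submodule.span ℝ {b 0, Complex.I • b 0, b 1})
      (reCoordOne b) (b 1) (2 ^ i) (√2 ^ i * κ) := by
  have : FiniteDimensional ℝ W := FiniteDimensional.complexToReal W
  have hW : finrank ℂ W = 2 := by simpa using finrank_eq_card_basis b
  have h2 : (√2 : ℂ) * √2 = 2 := by
    rw [← Complex.ofReal_mul, Real.mul_self_sqrt (by norm_num)]; norm_num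
  have h2' : (√2 : ℂ) ≠ 0 := fun h => by simp [h] at h2
  refine ⟨hf.2.1 i u, ?_, hf.2.2.1 i u, Submodule.subset_span (by simp), ?_, ?_, ?_, ?_⟩
  · refine isSimpleOn_of_forall_finrank_lt (hf.2.2.1 i u) fun G hG K hK => ?_
    rw [finrank_span_triple] at hG
    exact component_eq_zero_of_finrank_le_two hW hZg hf hsum hi G (by omega) K hK u
  · simpa using reCoordOne_apply b 0 1
  · intro c hc hc0 K K' hK hK'
    obtain ⟨β, r, rfl⟩ := (mem_span_triple_iff _ _ _).1 hc
    rw [reCoordOne_apply] at hc0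
    subst hc0
    obtain ⟨g, hg, hg0, hg1⟩ := exists_sl_equiv_shear b β
    have : K' = K.mapCLM (cReal (g : W →ₗ[ℂ] W)) := by
      apply SetLike.coe_injective
      rw [hK']
      refine Set.image_congr fun y hy => ?_
      obtain ⟨z, r, rfl⟩ := (mem_span_triple_iff _ _ _).1 (hK hy)
      rw [reCoordOne_apply]
      change _ = g _
      simp only [← Complex.coe_smul, map_add, map_smul, hg0, hg1]
      simp only [Complex.ofReal_zero]
      module
    rw [this, component_mapCLM hZg hf hsum g hg hi', hshear g β hg0 hg1 K hK]
  · intro K _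
    exact hf.2.2.2.1 i K u 2 (by norm_num)
  · intro K K' hK hK'
    obtain ⟨g, hg, hg0, hg1⟩ := exists_sl_equiv_diag b h2'
    have : K' = √2 • K.mapCLM (cReal (g : W →ₗ[ℂ] W)) := by
      apply SetLike.coe_injective
      rw [hK', ConvexBody.coe_smul]
      change _ = √2 • ((g : W → W) '' (K : Set W))
      rw [← Set.image_smul, Set.image_image]
      refine Set.image_congr fun y hy => ?_
      obtain ⟨z, r, rfl⟩ := (mem_span_triple_iff _ _ _).1 (hK hy)
      rw [reCoordOne_apply]
      simp only [← Complex.coe_smul, map_add, map_smul, hg0, hg1]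
      simp only [smul_smul, smul_add, mul_left_comm (√2 : ℂ), h2, mul_inv_cancel₀ h2']
      push_cast
      module
    simp only [this]
    rw [hf.2.2.2.1 _ _ _ _ (by positivity), component_mapCLM hZg hf hsum g hg hi',
      hdiag g hg0 hg1, hf.2.2.2.2.2 _ _ _ _ hκ]
    ring

theorem component_two_eq_zero (hZg : IsSLContravariant Z) (hf : McMullenProps f)
    (hsum : ∀ (K : ConvexBody W) (u : W),
      hSupp (Z K) (fun ξ => (ξ u).re) = ∑ i ∈ Finset.range 5, f i K u)
    (b : Basis (Fin 2) ℂ W) (K : ConvexBody W)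
    (hK : (K : Set W) ⊆ Submodule.span ℝ {b 0, Complex.I • b 0, b 1}) (u : W) :
    f 2 K u = 0 := by
  have : FiniteDimensional ℝ W := FiniteDimensional.complexToReal W
  have hsq : √2 * √2 = (2 : ℝ) := Real.mul_self_sqrt (by norm_num)
  have h1 : 1 < √2 := by rw [Real.lt_sqrt] <;> norm_num
  have h2 : √2 < 3 / 2 := by rw [Real.sqrt_lt'] <;> norm_num
  have hs0 : √2 ≠ 0 := by positivity
  have hline : ∀ i, 2 ≤ i → i < 5 → ∀ (K : ConvexBody W),
      (K : Set W) ⊆ Submodule.span ℝ {b 0, Complex.I • b 0, b 1} → ∀ z : ℂ,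
      f i K (z • b 0) = 0 := by
    intro i hi hi' K hK z
    have H := isShearInvariantOn_component hZg hf hsum b hi hi' (u := z • b 0) (κ := (√2)⁻¹)
      (by positivity)
      (fun g β hg0 _ K _ => by
        have : g.symm (z • b 0) = z • b 0 := by
          rw [ContinuousLinearEquiv.symm_apply_eq, map_smul, hg0]
        rw [this])
      (fun g hg0 _ => by
        rw [ContinuousLinearEquiv.symm_apply_eq, ← Complex.coe_smul, map_smul, map_smul, hg0,
          smul_comm z, smul_smul, ← Complex.ofReal_mul, inv_mul_cancel₀ hs0]
        simp)
    refine H.eq_zero (hf.1 i _) (finrank_span_triple b) ?_ ?_ K hK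
    · interval_cases i
      · rw [show √2 ^ 2 * (√2)⁻¹ = √2 by field_simp]; linarith
      · rw [show √2 ^ 3 * (√2)⁻¹ = √2 * √2 by field_simp, hsq]; norm_num
      · rw [show √2 ^ 4 * (√2)⁻¹ = √2 * √2 * √2 by field_simp, hsq]; linarith
    · interval_cases i
      · rw [show √2 ^ 2 * (√2)⁻¹ = √2 by field_simp]; nlinarith
      · rw [show √2 ^ 3 * (√2)⁻¹ = √2 * √2 by field_simp, hsq]; norm_num
      · rw [show √2 ^ 4 * (√2)⁻¹ = √2 * √2 * √2 by field_simp, hsq]; nlinarith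
  have hadd : ∀ n, ∀ i, 2 ≤ i → i + n = 4 → ∀ (K : ConvexBody W),
      (K : Set W) ⊆ Submodule.span ℝ {b 0, Complex.I • b 0, b 1} → ∀ (z : ℂ) (u : W),
      f i K (u + z • b 0) = f i K u := by
    intro n
    induction n using Nat.strong_induction_on with
    | _ n ih =>
      intro i hi hin K hK z u
      have hle : ∀ (z : ℂ) (u : W), f i K (u + z • b 0) ≤ f i K u := fun z u => by
        have := component_add_le hf hsum (k := i) (by omega) K u (z • b 0) fun j hj hj' => by
          rw [ih (4 - j) (by omega) j (by omega) (by omega) K hK,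
            hline j (by omega) hj' K hK, add_zero]
        rwa [hline i hi (by omega) K hK, add_zero] at this
      refine le_antisymm (hle z u) ?_
      have := hle (-z) (u + z • b 0)
      rwa [neg_smul, add_neg_cancel_right] at this
  have hu : u = b.repr u 1 • b 1 + b.repr u 0 • b 0 := by
    rw [add_comm, ← Fin.sum_univ_two (fun i => b.repr u i • b i), b.sum_repr]
  rw [hu, hadd 2 2 le_rfl rfl K hK]
  set z := b.repr u 1
  have H := isShearInvariantOn_component hZg hf hsum b le_rfl (by norm_num) (u := z • b 1)
    (κ := √2) (by positivity)
    (fun g β hg0 hg1 K hK => by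
      have : g.symm (z • b 1) = z • b 1 + (-(z * β)) • b 0 := by
        rw [ContinuousLinearEquiv.symm_apply_eq, map_add, map_smul, map_smul, hg0, hg1]
        module
      rw [this, hadd 2 2 le_rfl rfl K hK])
    (fun g _ hg1 => by
      rw [ContinuousLinearEquiv.symm_apply_eq, ← Complex.coe_smul, map_smul, map_smul, hg1,
        smul_comm z, smul_smul, mul_inv_cancel₀ (by exact_mod_cast hs0), one_smul])
  have hρ : √2 ^ 2 * √2 = 2 * √2 := by rw [pow_two, hsq]
  refine H.eq_zero (hf.1 2 _) (finrank_span_triple b) ?_ ?_ K hK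
  · rw [hρ]; linarith
  · rw [hρ]; nlinarith

end ThreeDimensional

section WulffShapes

theorem hasDerivWithinAt_of_cubic_bounds {g : ℝ → ℝ} {v s : ℝ} (hv : 0 ≤ v) (hg : g 0 = v)
    (hu : ∀ᶠ t in nhdsWithin 0 (Set.Ici 0), g t ≤ (1 + t * s) ^ 3 * v)
    (hl : ∀ η > 0, ∃ C, ∀ᶠ t in nhdsWithin 0 (Set.Ici 0),
      (1 + t * (s - η)) ^ 3 * v - C * t ^ 2 ≤ g t) :
    HasDerivWithinAt g (3 * s * v) (Set.Ici 0) 0 := by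
  have hderiv : ∀ r C : ℝ, HasDerivWithinAt (fun t : ℝ => (1 + t * r) ^ 3 * v - C * t ^ 2)
      (3 * r * v) (Set.Ici 0) 0 := fun r C => by
    have h1 : HasDerivAt (fun t : ℝ => 1 + t * r) r 0 := by
      simpa using ((hasDerivAt_id (0 : ℝ)).mul_const r).const_add 1
    have h2 := ((h1.pow 3).mul_const v).sub (((hasDerivAt_id (0 : ℝ)).pow 2).const_mul C)
    have h3 := h2.hasDerivWithinAt (s := Set.Ici 0)
    refine h3.congr_deriv ?_
    simp
  rw [hasDerivWithinAt_iff_isLittleO, Asymptotics.isLittleO_iff]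
  intro c hc
  obtain ⟨C, hC⟩ := hl (c / (6 * v + 1)) (by positivity)
  set η := c / (6 * v + 1)
  have hη : 3 * η * v ≤ c / 2 := by
    have : η * (6 * v + 1) = c := div_mul_cancel₀ _ (by positivity)
    have : 0 ≤ η := by positivity
    nlinarith
  have h1 := (Asymptotics.isLittleO_iff.1 (hasDerivWithinAt_iff_isLittleO.1 (hderiv s 0))) hc
  have h2 := (Asymptotics.isLittleO_iff.1 (hasDerivWithinAt_iff_isLittleO.1 (hderiv (s - η) C)))
    (half_pos hc)
  filter_upwards [h1, h2, hu, hC, self_mem_nhdsWithin] with t h1 h2 hu hC ht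
  have ht0 : 0 ≤ t := ht
  rw [Real.norm_eq_abs, Real.norm_eq_abs, abs_le] at h1 h2 ⊢
  simp only [sub_zero, smul_eq_mul, abs_of_nonneg ht0, hg] at h1 h2 ⊢
  have := mul_le_mul_of_nonneg_left hη ht0
  norm_num at h1 h2
  constructor <;> nlinarith [h1.2, h2.1]

variable {V : Type*} [NormedAddCommGroup V] [NormedSpace ℝ V]

theorem apply_zero_of_homogeneous {ψ : V → ℝ}
    (hh : ∀ (ξ : V) (t : ℝ), 0 < t → ψ (t • ξ) = t * ψ ξ) : ψ 0 = 0 := by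
  have := hh 0 2 (by norm_num)
  rw [smul_zero] at this
  linarith

theorem exists_abs_le_of_homogeneous [FiniteDimensional ℝ V] {ψ : V → ℝ} (hc : Continuous ψ)
    (hh : ∀ (ξ : V) (t : ℝ), 0 < t → ψ (t • ξ) = t * ψ ξ) : ∃ C, 0 ≤ C ∧ ∀ ξ, |ψ ξ| ≤ C * ‖ξ‖ := by
  have : ProperSpace V := FiniteDimensional.proper ℝ V
  obtain ⟨C, hC⟩ := (isCompact_sphere (0 : V) 1).exists_bound_of_continuousOn hc.continuousOn
  refine ⟨max C 0, le_max_right _ _, fun ξ => ?_⟩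
  rcases eq_or_ne ξ 0 with rfl | hξ
  · simp [apply_zero_of_homogeneous hh]
  · have hpos : 0 < ‖ξ‖ := norm_pos_iff.2 hξ
    have h1 : ξ = ‖ξ‖ • (‖ξ‖⁻¹ • ξ) := by rw [smul_smul, mul_inv_cancel₀ hpos.ne', one_smul]
    have h2 := hC (‖ξ‖⁻¹ • ξ) (by
      rw [mem_sphere_zero_iff_norm, norm_smul, norm_inv, norm_norm, inv_mul_cancel₀ hpos.ne'])
    rw [Real.norm_eq_abs] at h2
    conv_lhs => rw [h1, hh _ _ hpos, abs_mul, abs_of_pos hpos, mul_comm]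
    exact mul_le_mul_of_nonneg_right (h2.trans (le_max_left _ _)) hpos.le

theorem exists_lower_bound_of_homogeneous [FiniteDimensional ℝ V] {ψ : V → ℝ} (hc : Continuous ψ)
    (hh : ∀ (ξ : V) (t : ℝ), 0 < t → ψ (t • ξ) = t * ψ ξ) (n : V) {η : ℝ} (hη : 0 < η) :
    ∃ M, 0 ≤ M ∧ ∀ c, 0 ≤ c → ∀ w, (ψ n - η) * c - M * ‖w‖ ≤ ψ (c • n + w) := by
  obtain ⟨C, hC0, hC⟩ := exists_abs_le_of_homogeneous hc hh
  obtain ⟨δ, hδ, hball⟩ := Metric.continuous_iff.1 hc n η hη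
  refine ⟨(C * ‖n‖ + |ψ n - η|) / δ + C, by positivity, fun c hc0 w => ?_⟩
  have hlow := neg_le_of_abs_le (hC (c • n + w))
  rcases lt_or_ge ‖w‖ (δ * c) with hw | hw
  · have hcpos : 0 < c := by
      rcases hc0.eq_or_lt with rfl | h
      · rw [mul_zero] at hw; exact absurd hw (not_lt.2 (norm_nonneg _))
      · exact h
    have h1 : c • n + w = c • (n + c⁻¹ • w) := by
      rw [smul_add, smul_smul, mul_inv_cancel₀ hcpos.ne', one_smul]
    have h2 := hball (n + c⁻¹ • w) (by
      rw [dist_self_add_left, norm_smul, norm_inv, Real.norm_eq_abs, abs_of_pos hcpos,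
        inv_mul_lt_iff₀ hcpos, mul_comm]
      exact hw)
    rw [Real.dist_eq, abs_lt] at h2
    rw [h1, hh _ _ hcpos]
    have h3 : 0 ≤ ((C * ‖n‖ + |ψ n - η|) / δ + C) * ‖w‖ := by positivity
    nlinarith [h2.1]
  · have h1 : ‖c • n + w‖ ≤ c * ‖n‖ + ‖w‖ := by
      refine (norm_add_le _ _).trans ?_
      rw [norm_smul, Real.norm_eq_abs, abs_of_nonneg hc0]
    have h2 := mul_le_mul_of_nonneg_left h1 hC0
    have h3 : (C * ‖n‖ + |ψ n - η|) * c ≤ (C * ‖n‖ + |ψ n - η|) / δ * ‖w‖ := by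
      rw [div_mul_eq_mul_div, le_div_iff₀ hδ, mul_assoc, mul_comm c]
      exact mul_le_mul_of_nonneg_left hw (by positivity)
    have h4 := mul_le_mul_of_nonneg_right (le_abs_self (ψ n - η)) hc0
    nlinarith

/-- The volume of a box given by three functionals is proportional to its side lengths. -/
theorem exists_measureReal_box_eq [FiniteDimensional ℝ V] [MeasurableSpace V] [BorelSpace V]
    (μ : Measure V) [μ.IsAddHaarMeasure] (hV : finrank ℝ V = 3) (a : Fin 3 → V →L[ℝ] ℝ)
    (ha : ∀ x, (∀ i, a i x = 0) → x = 0) :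
    ∃ C, 0 ≤ C ∧ ∀ p q : Fin 3 → ℝ, (∀ i, p i ≤ q i) →
      IsCompact {x | ∀ i, p i ≤ a i x ∧ a i x ≤ q i} ∧
      μ.real {x | ∀ i, p i ≤ a i x ∧ a i x ≤ q i} = C * ∏ i, (q i - p i) := by
  let L₀ : V →ₗ[ℝ] (Fin 3 → ℝ) := LinearMap.pi fun i => (a i : V →ₗ[ℝ] ℝ)
  have hinj : Function.Injective L₀ := by
    rw [← LinearMap.ker_eq_bot, LinearMap.ker_eq_bot']
    exact fun x hx => ha x fun i => congrFun hx i
  let L : V ≃L[ℝ] (Fin 3 → ℝ) :=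
    (LinearEquiv.ofInjectiveOfFinrankEq L₀ hinj (by simp [hV])).toContinuousLinearEquiv
  have hL : ∀ x i, L x i = a i x := fun x i => rfl
  have hset : ∀ p q : Fin 3 → ℝ, {x | ∀ i, p i ≤ a i x ∧ a i x ≤ q i} = L ⁻¹' Set.Icc p q := by
    intro p q
    ext x
    simp only [Set.mem_ofPred_eq, Set.mem_preimage, Set.mem_Icc, Pi.le_def, hL, forall_and]
  have hHaar : (μ.map L).IsAddHaarMeasure := L.isAddHaarMeasure_map μ
  refine ⟨(Measure.addHaarScalarFactor (μ.map L) volume : ℝ), NNReal.coe_nonneg _,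
    fun p q hpq => ⟨?_, ?_⟩⟩
  · rw [hset]
    exact L.toHomeomorph.isCompact_preimage.2 isCompact_Icc
  · have h1 : μ.real (L ⁻¹' Set.Icc p q) = (μ.map L).real (Set.Icc p q) := by
      rw [map_measureReal_apply L.continuous.measurable measurableSet_Icc]
    have h2 := congrArg (fun ν => ν.real (Set.Icc p q))
      (Measure.isAddLeftInvariant_eq_smul (μ.map L) volume)
    rw [measureReal_nnreal_smul_apply] at h2
    rw [hset, h1, h2, Measure.real, Real.volume_Icc_pi_toReal hpq]

end WulffShapes

section Simplices

variable {V : Type*} [NormedAddCommGroup V] [NormedSpace ℝ V]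

/-- Four functionals on a space of dimension three which sum up to zero and span the dual space
are the facet normals of a simplex. -/
structure IsSimplexNormals (n : Fin 4 → V →L[ℝ] ℝ) : Prop where
  sum_eq_zero : ∑ i, n i = 0
  span : ∀ ξ : V →L[ℝ] ℝ, ∃ a : Fin 4 → ℝ, ξ = ∑ i, a i • n i
  vertex : ∀ i, ∃ v, ∀ j, j ≠ i → n j v = 1

/-- The simplex with facet normals `n` and all facets at distance `r` from the origin. -/
def simplexSet (n : Fin 4 → V →L[ℝ] ℝ) (r : ℝ) : Set V := {x | ∀ i, n i x ≤ r}

namespace IsSimplexNormals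

variable {n : Fin 4 → V →L[ℝ] ℝ}

theorem sum_apply (hn : IsSimplexNormals n) (x : V) : ∑ i, n i x = 0 := by
  simpa using congrArg (fun ξ : V →L[ℝ] ℝ => ξ x) hn.sum_eq_zero

theorem apply_eq (hn : IsSimplexNormals n) (x : V) (i : Fin 4) :
    n i x = -∑ j ∈ Finset.univ.erase i, n j x := by
  have := hn.sum_apply x
  rw [← Finset.add_sum_erase _ _ (Finset.mem_univ i)] at this
  linarith

theorem neg_le (hn : IsSimplexNormals n) {r : ℝ} {x : V} (hx : x ∈ simplexSet n r) (i : Fin 4) :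
    -(3 * r) ≤ n i x := by
  rw [hn.apply_eq, neg_le_neg_iff]
  refine (Finset.sum_le_card_nsmul _ _ r fun j _ => hx j).trans ?_
  simp

theorem eq_zero_of_apply_eq_zero (hn : IsSimplexNormals n) {i j k : Fin 4} (hij : i ≠ j)
    (hik : i ≠ k) (hjk : j ≠ k) {x : V} (hi : n i x = 0) (hj : n j x = 0) (hk : n k x = 0) :
    x = 0 := by
  have hcover : ∀ i j k : Fin 4, i ≠ j → i ≠ k → j ≠ k →
      ∃ l, ∀ m, m ≠ l → m = i ∨ m = j ∨ m = k := by decide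
  obtain ⟨l, hl⟩ := hcover i j k hij hik hjk
  have h0 : ∀ m, m ≠ l → n m x = 0 := fun m hm => by
    rcases hl m hm with rfl | rfl | rfl <;> assumption
  have hall : ∀ m, n m x = 0 := fun m => by
    rcases eq_or_ne m l with rfl | hm
    · rw [hn.apply_eq, neg_eq_zero]
      exact Finset.sum_eq_zero fun m hm => h0 m (Finset.ne_of_mem_erase hm)
    · exact h0 m hm
  by_contra hx
  obtain ⟨ξ, hξ⟩ := SeparatingDual.exists_ne_zero (R := ℝ) hx
  obtain ⟨a, rfl⟩ := hn.span ξ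
  exact hξ (by simp [hall])

theorem exists_measureReal_box_eq [FiniteDimensional ℝ V] [MeasurableSpace V] [BorelSpace V]
    (hn : IsSimplexNormals n) (μ : Measure V) [μ.IsAddHaarMeasure] (hV : finrank ℝ V = 3)
    {i j k : Fin 4} (hij : i ≠ j) (hik : i ≠ k) (hjk : j ≠ k) :
    ∃ C, 0 ≤ C ∧ ∀ p q : Fin 3 → ℝ, (∀ i, p i ≤ q i) →
      IsCompact {x | ∀ m, p m ≤ n (![i, j, k] m) x ∧ n (![i, j, k] m) x ≤ q m} ∧
      μ.real {x | ∀ m, p m ≤ n (![i, j, k] m) x ∧ n (![i, j, k] m) x ≤ q m}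
        = C * ∏ m, (q m - p m) :=
  _root_.exists_measureReal_box_eq μ hV (fun m => n (![i, j, k] m)) fun _ hx =>
    hn.eq_zero_of_apply_eq_zero hij hik hjk (hx 0) (hx 1) (hx 2)

theorem isClosed_simplexSet (r : ℝ) : IsClosed (simplexSet n r) := by
  simp only [simplexSet, Set.ofPred_forall]
  exact isClosed_iInter fun i => isClosed_le (n i).continuous continuous_const

theorem isCompact_simplexSet [FiniteDimensional ℝ V] (hn : IsSimplexNormals n)
    (hV : finrank ℝ V = 3) {r : ℝ} (hr : 0 ≤ r) : IsCompact (simplexSet n r) := by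
  borelize V
  obtain ⟨C, -, hC⟩ := hn.exists_measureReal_box_eq (Measure.addHaar : Measure V) hV
    (i := 0) (j := 1) (k := 2) (by decide) (by decide) (by decide)
  exact (hC (fun _ => -(3 * r)) (fun _ => r) fun _ => by linarith).1.of_isClosed_subset
    (isClosed_simplexSet r) fun x hx m => ⟨hn.neg_le hx _, hx _⟩

theorem convex_simplexSet (r : ℝ) : Convex ℝ (simplexSet n r) := by
  simp only [simplexSet, Set.ofPred_forall]
  exact convex_iInter fun i => convex_halfSpace_le (n i).isLinear r

/-- The simplex with facet normals `n`, as a convex body. -/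
def body [FiniteDimensional ℝ V] (hn : IsSimplexNormals n) (hV : finrank ℝ V = 3) :
    ConvexBody V :=
  ⟨simplexSet n 1, convex_simplexSet 1, hn.isCompact_simplexSet hV zero_le_one,
    ⟨0, fun i => by simp⟩⟩

section Measure

variable [FiniteDimensional ℝ V] [MeasurableSpace V] [BorelSpace V]

theorem measureReal_simplexSet (μ : Measure V) [μ.IsAddHaarMeasure]
    (hV : finrank ℝ V = 3) {r : ℝ} (hr : 0 < r) :
    μ.real (simplexSet n r) = r ^ 3 * μ.real (simplexSet n 1) := by
  have : simplexSet n r = r • simplexSet n 1 := by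
    ext x
    rw [Set.mem_smul_set_iff_inv_smul_mem₀ hr.ne']
    simp [simplexSet, inv_mul_le_iff₀ hr]
  rw [this, Measure.real, Measure.addHaar_smul, hV, ENNReal.toReal_mul,
    ENNReal.toReal_ofReal (abs_nonneg _), abs_of_pos (by positivity), Measure.real]

omit [BorelSpace V] in
theorem measureReal_simplexSet_pos (hn : IsSimplexNormals n) (μ : Measure V) [μ.IsAddHaarMeasure]
    (hV : finrank ℝ V = 3) : 0 < μ.real (simplexSet n 1) := by
  refine ENNReal.toReal_pos ?_ (hn.isCompact_simplexSet hV zero_le_one).measure_lt_top.ne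
  refine (μ.measure_pos_of_nonempty_interior ⟨0, ?_⟩).ne'
  refine mem_interior.2 ⟨⋂ i, {x | n i x < 1}, fun x hx i => (Set.mem_iInter.1 hx i).le,
    isOpen_iInter_of_finite fun i => isOpen_lt (n i).continuous continuous_const, ?_⟩
  simp

/-- The part of a slightly perturbed simplex which is close to an edge has volume of second order
in the size of the perturbation. -/
theorem exists_measureReal_edge_le (hn : IsSimplexNormals n) (μ : Measure V) [μ.IsAddHaarMeasure]
    (hV : finrank ℝ V = 3) {i j : Fin 4} (hij : i ≠ j) {A M : ℝ} (hAM : 0 ≤ A + M) :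
    ∃ C, ∀ t, 0 ≤ t → |t * A| ≤ 1 →
      μ.real (simplexSet n (1 + t * A) ∩ {x | 1 - t * M < n i x ∧ 1 - t * M < n j x})
        ≤ C * t ^ 2 := by
  have hthird : ∀ i j : Fin 4, ∃ k, i ≠ k ∧ j ≠ k := by decide
  obtain ⟨k, hik, hjk⟩ := hthird i j
  obtain ⟨C, -, hC⟩ := hn.exists_measureReal_box_eq μ hV hij hik hjk
  refine ⟨C * ((A + M) ^ 2 * 8), fun t ht hA => ?_⟩
  rw [abs_le] at hA
  have hle := mul_nonneg ht hAM
  obtain ⟨hc, h⟩ := hC ![1 - t * M, 1 - t * M, -6] ![1 + t * A, 1 + t * A, 2] (fun m => by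
    fin_cases m
    · change 1 - t * M ≤ 1 + t * A
      linarith
    · change 1 - t * M ≤ 1 + t * A
      linarith
    · change (-6 : ℝ) ≤ 2
      norm_num)
  refine (measureReal_mono ?_ hc.measure_lt_top.ne).trans (h.trans ?_).le
  · rintro x ⟨hx, hxi, hxj⟩ m
    fin_cases m
    · exact ⟨hxi.le, hx i⟩
    · exact ⟨hxj.le, hx j⟩
    · have h1 := hn.neg_le hx k
      have h2 := hx k
      change (-6 : ℝ) ≤ n k x ∧ n k x ≤ 2
      constructor <;> linarith
  · simp [Fin.prod_univ_three]
    ring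

end Measure

theorem sum_le_hSupp_body [FiniteDimensional ℝ V] (hn : IsSimplexNormals n)
    (hV : finrank ℝ V = 3) {c : Fin 4 → ℝ} {i : Fin 4} (hi : c i = 0) :
    ∑ k, c k ≤ hSupp (hn.body hV) (∑ k, c k • n k : V →L[ℝ] ℝ) := by
  obtain ⟨v, hv⟩ := hn.vertex i
  have hvT : v ∈ ((hn.body hV : ConvexBody V) : Set V) := by
    intro j
    rcases eq_or_ne j i with rfl | hj
    · rw [hn.apply_eq, Finset.sum_congr rfl fun k hk => hv k (Finset.ne_of_mem_erase hk)]
      norm_num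
    · exact (hv j hj).le
  refine le_trans (le_of_eq ?_) (le_hSupp _ (∑ k, c k • n k : V →L[ℝ] ℝ).continuous hvT)
  rw [_root_.sum_apply]
  refine Finset.sum_congr rfl fun k _ => ?_
  rcases eq_or_ne k i with rfl | hk
  · simp [hi]
  · simp [hv k hk]

theorem exists_nonneg_combination (hn : IsSimplexNormals n) (ξ : V →L[ℝ] ℝ) :
    ∃ (c : Fin 4 → ℝ) (i : Fin 4), (∀ k, 0 ≤ c k) ∧ c i = 0 ∧ ξ = ∑ k, c k • n k := by
  obtain ⟨a, rfl⟩ := hn.span ξ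
  obtain ⟨i, hi⟩ := Finite.exists_min a
  refine ⟨fun k => a k - a i, i, fun k => sub_nonneg.2 (hi k), sub_self _, ?_⟩
  have h : ∀ k, (a k - a i) • n k = a k • n k - a i • n k := fun k => by
    ext; simp [sub_mul]
  rw [Finset.sum_congr rfl fun k _ => h k, Finset.sum_sub_distrib, ← Finset.smul_sum,
    hn.sum_eq_zero, smul_zero, sub_zero]

end IsSimplexNormals

end Simplices

section MixedVolumeUniqueness

variable {V : Type*} [NormedAddCommGroup V] [NormedSpace ℝ V] [FiniteDimensional ℝ V]

namespace IsSimplexNormals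

variable {n : Fin 4 → V →L[ℝ] ℝ} {ψ : (V →L[ℝ] ℝ) → ℝ} {s : ℝ}

theorem wulff_subset_simplexSet (hn : IsSimplexNormals n) (hV : finrank ℝ V = 3)
    (hs : ∀ i, ψ (n i) = s) (t : ℝ) :
    {x : V | ∀ ξ : V →L[ℝ] ℝ, ξ x ≤ hSupp (hn.body hV) ξ + t * ψ ξ} ⊆ simplexSet n (1 + t * s) := by
  intro x hx i
  have h1 := hx (n i)
  have h2 : hSupp (hn.body hV) (n i) ≤ 1 := by
    refine csSup_le ((hn.body hV).nonempty.image _) ?_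
    rintro _ ⟨y, hy, rfl⟩
    exact hy i
  rw [hs] at h1
  linarith

theorem exists_simplexSet_subset_wulff (hn : IsSimplexNormals n) (hV : finrank ℝ V = 3)
    (hc : Continuous ψ) (hh : ∀ (ξ : V →L[ℝ] ℝ) (t : ℝ), 0 < t → ψ (t • ξ) = t * ψ ξ)
    (hs : ∀ i, ψ (n i) = s) {η : ℝ} (hη : 0 < η) :
    ∃ M, 0 ≤ s - η + M ∧ ∀ t, 0 ≤ t → ∀ x ∈ simplexSet n (1 + t * (s - η)),
      (∀ i j, i ≠ j → 1 - t * M < n i x → n j x ≤ 1 - t * M) →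
      ∀ ξ : V →L[ℝ] ℝ, ξ x ≤ hSupp (hn.body hV) ξ + t * ψ ξ := by
  choose m hm0 hm using fun i => exists_lower_bound_of_homogeneous hc hh (n i) hη
  set N := ∑ k, ‖n k‖
  set A := s - η
  have hN : ∀ k, ‖n k‖ ≤ N := fun k =>
    Finset.single_le_sum (f := fun k => ‖n k‖) (fun k _ => norm_nonneg _) (Finset.mem_univ k)
  have hmle : ∀ k, m k ≤ ∑ i, m i := fun k =>
    Finset.single_le_sum (fun k _ => hm0 k) (Finset.mem_univ k)
  have hm' : 0 ≤ ∑ i, m i := Finset.sum_nonneg fun k _ => hm0 k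
  have hN' : 0 ≤ N := (norm_nonneg _).trans (hN 0)
  refine ⟨(∑ i, m i) * N + |A|, ?_, fun t ht x hx hpair ξ => ?_⟩
  · have := neg_abs_le A
    have := mul_nonneg hm' hN'
    linarith
  set M := (∑ i, m i) * N + |A|
  obtain ⟨c, i, hc0, hci, rfl⟩ := hn.exists_nonneg_combination ξ
  obtain ⟨k, hk⟩ : ∃ k, ∀ j, j ≠ k → n j x ≤ 1 - t * M := by
    by_cases h : ∃ k, 1 - t * M < n k x
    · obtain ⟨k, hk⟩ := h
      exact ⟨k, fun j hj => hpair k j hj.symm hk⟩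
    · push Not at h
      exact ⟨0, fun j _ => h j⟩
  set S := ∑ j ∈ Finset.univ.erase k, c j
  have hS : 0 ≤ S := Finset.sum_nonneg fun j _ => hc0 j
  have hψ : A * c k - M * S ≤ ψ (∑ j, c j • n j) := by
    rw [← Finset.add_sum_erase _ _ (Finset.mem_univ k)]
    refine le_trans ?_ (hm k (c k) (hc0 k) _)
    rw [hs]
    refine sub_le_sub_left ?_ _
    have hw : ‖∑ j ∈ Finset.univ.erase k, c j • n j‖ ≤ S * N := by
      rw [Finset.sum_mul]
      refine norm_sum_le_of_le _ fun j _ => ?_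
      rw [norm_smul, Real.norm_eq_abs, abs_of_nonneg (hc0 j)]
      exact mul_le_mul_of_nonneg_left (hN j) (hc0 j)
    calc m k * ‖∑ j ∈ Finset.univ.erase k, c j • n j‖ ≤ (∑ i, m i) * (S * N) :=
          mul_le_mul (hmle k) hw (norm_nonneg _) hm'
      _ ≤ M * S := by nlinarith [mul_nonneg (abs_nonneg A) hS]
  have hsupp := hn.sum_le_hSupp_body hV hci
  rw [← Finset.add_sum_erase _ _ (Finset.mem_univ k)] at hsupp
  have hx' : (∑ j, c j • n j) x ≤ c k * (1 + t * A) + S * (1 - t * M) := by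
    rw [_root_.sum_apply, ← Finset.add_sum_erase _ _ (Finset.mem_univ k), Finset.sum_mul]
    exact add_le_add (mul_le_mul_of_nonneg_left (hx k) (hc0 k))
      (Finset.sum_le_sum fun j hj =>
        mul_le_mul_of_nonneg_left (hk j (Finset.ne_of_mem_erase hj)) (hc0 j))
  have := mul_le_mul_of_nonneg_left hψ ht
  change c k + S ≤ _ at hsupp
  nlinarith

variable [MeasurableSpace V] [BorelSpace V]

theorem hasDerivWithinAt_wulff (hn : IsSimplexNormals n) (μ : Measure V) [μ.IsAddHaarMeasure]
    (hV : finrank ℝ V = 3)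
    (hc : Continuous ψ) (hh : ∀ (ξ : V →L[ℝ] ℝ) (t : ℝ), 0 < t → ψ (t • ξ) = t * ψ ξ)
    (hs : ∀ i, ψ (n i) = s) :
    HasDerivWithinAt (fun t : ℝ =>
      (μ {x : V | ∀ ξ : V →L[ℝ] ℝ, ξ x ≤ hSupp (hn.body hV) ξ + t * ψ ξ}).toReal)
      (3 * s * μ.real (simplexSet n 1)) (Set.Ici 0) 0 := by
  have hsmall : ∀ r : ℝ, ∀ᶠ t in nhdsWithin (0 : ℝ) (Set.Ici 0), |t * r| < 1 := fun r => by
    refine Filter.Eventually.filter_mono nhdsWithin_le_nhds ?_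
    have : Filter.Tendsto (fun t : ℝ => |t * r|) (nhds 0) (nhds |0 * r|) :=
      Continuous.tendsto (by fun_prop) 0
    exact this.eventually (gt_mem_nhds (by simp))
  have hfin : ∀ t, |t * s| < 1 →
      μ {x : V | ∀ ξ : V →L[ℝ] ℝ, ξ x ≤ hSupp (hn.body hV) ξ + t * ψ ξ} ≠ ⊤ := fun t ht =>
    ((measure_mono (hn.wulff_subset_simplexSet hV hs t)).trans_lt
      (hn.isCompact_simplexSet hV (by linarith [(abs_lt.1 ht).1])).measure_lt_top).ne
  refine hasDerivWithinAt_of_cubic_bounds measureReal_nonneg ?_ ?_ fun η hη => ?_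
  · change μ.real _ = μ.real _
    congr 1
    refine Set.Subset.antisymm ?_ fun x hx ξ => ?_
    · simpa using hn.wulff_subset_simplexSet hV hs 0
    · rw [zero_mul, add_zero]
      exact le_hSupp (hn.body hV) ξ.continuous hx
  · filter_upwards [hsmall s] with t ht
    have hpos : 0 < 1 + t * s := by linarith [(abs_lt.1 ht).1]
    rw [← measureReal_simplexSet μ hV hpos]
    exact measureReal_mono (hn.wulff_subset_simplexSet hV hs t)
      (hn.isCompact_simplexSet hV hpos.le).measure_lt_top.ne
  · obtain ⟨M, hM, hsub⟩ := hn.exists_simplexSet_subset_wulff hV hc hh hs hη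
    have hedge : ∀ p : Fin 4 × Fin 4, ∃ C, p.1 ≠ p.2 → ∀ t, 0 ≤ t → |t * (s - η)| ≤ 1 →
        μ.real (simplexSet n (1 + t * (s - η)) ∩
          {x | 1 - t * M < n p.1 x ∧ 1 - t * M < n p.2 x}) ≤ C * t ^ 2 := fun p => by
      by_cases hp : p.1 = p.2
      · exact ⟨0, fun h => absurd hp h⟩
      · obtain ⟨C, hC⟩ := hn.exists_measureReal_edge_le μ hV hp hM
        exact ⟨C, fun _ => hC⟩
    choose C hC using hedge
    refine ⟨∑ p ∈ Finset.univ.offDiag, C p, ?_⟩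
    filter_upwards [hsmall s, hsmall (s - η), self_mem_nhdsWithin] with t hts htη ht
    have hpos : 0 < 1 + t * (s - η) := by linarith [(abs_lt.1 htη).1]
    rw [← measureReal_simplexSet μ hV hpos]
    have hfin' : μ (simplexSet n (1 + t * (s - η))) ≠ ⊤ :=
      (hn.isCompact_simplexSet hV hpos.le).measure_lt_top.ne
    have hcover : simplexSet n (1 + t * (s - η)) ⊆
        {x : V | ∀ ξ : V →L[ℝ] ℝ, ξ x ≤ hSupp (hn.body hV) ξ + t * ψ ξ} ∪
        ⋃ p ∈ (Finset.univ : Finset (Fin 4)).offDiag, (simplexSet n (1 + t * (s - η)) ∩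
          {x | 1 - t * M < n p.1 x ∧ 1 - t * M < n p.2 x}) := by
      intro x hx
      by_cases h : ∀ i j, i ≠ j → 1 - t * M < n i x → n j x ≤ 1 - t * M
      · exact Or.inl (hsub t ht x hx h)
      · push Not at h
        obtain ⟨i, j, hij, hi, hj⟩ := h
        refine Or.inr (Set.mem_biUnion (x := (i, j)) ?_ ⟨hx, hi, hj⟩)
        simpa using hij
    have hfin'' : μ (⋃ p ∈ (Finset.univ : Finset (Fin 4)).offDiag,
        (simplexSet n (1 + t * (s - η)) ∩
          {x | 1 - t * M < n p.1 x ∧ 1 - t * M < n p.2 x})) ≠ ⊤ :=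
      ((measure_mono (Set.iUnion₂_subset fun p _ => Set.inter_subset_left)).trans_lt
        hfin'.lt_top).ne
    have h1 := measureReal_mono hcover (measure_union_lt_top (hfin t hts).lt_top hfin''.lt_top).ne
    have h2 := measureReal_union_le (μ := μ)
      {x : V | ∀ ξ : V →L[ℝ] ℝ, ξ x ≤ hSupp (hn.body hV) ξ + t * ψ ξ}
      (⋃ p ∈ (Finset.univ : Finset (Fin 4)).offDiag, (simplexSet n (1 + t * (s - η)) ∩
          {x | 1 - t * M < n p.1 x ∧ 1 - t * M < n p.2 x}))
    have h3 := measureReal_biUnion_finset_le (μ := μ) (Finset.univ : Finset (Fin 4)).offDiag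
      fun p => simplexSet n (1 + t * (s - η)) ∩ {x | 1 - t * M < n p.1 x ∧ 1 - t * M < n p.2 x}
    have h4 := Finset.sum_le_sum (s := (Finset.univ : Finset (Fin 4)).offDiag) fun p hp =>
      hC p (Finset.mem_offDiag.1 hp).2.2 t ht htη.le
    rw [← Finset.sum_mul] at h4
    rw [sub_le_iff_le_add]
    exact h1.trans (h2.trans (add_le_add_right (h3.trans h4) _))

theorem eq_zero_of_mixedVolFn_eq_zero (hn : IsSimplexNormals n) (μ : Measure V)
    [μ.IsAddHaarMeasure] (hV : finrank ℝ V = 3)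
    (hc : Continuous ψ) (hh : ∀ (ξ : V →L[ℝ] ℝ) (t : ℝ), 0 < t → ψ (t • ξ) = t * ψ ξ)
    (hs : ∀ i, ψ (n i) = s) (h : mixedVolFn μ (hn.body hV) ψ = 0) : s = 0 := by
  have h1 := (hn.hasDerivWithinAt_wulff μ hV hc hh hs).derivWithin
    (uniqueDiffOn_Ici (0 : ℝ) 0 Set.self_mem_Ici)
  rw [mixedVolFn, h1, hV] at h
  have h2 := hn.measureReal_simplexSet_pos μ hV
  have h3 : s * μ.real (simplexSet n 1) = 0 := by
    push_cast at h
    linarith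
  exact (mul_eq_zero.1 h3).resolve_right h2.ne'

end IsSimplexNormals

omit [FiniteDimensional ℝ V] in
theorem mixedVolFn_sub_apply [MeasurableSpace V] [BorelSpace V] (μ : Measure V)
    [μ.IsAddLeftInvariant] (K : ConvexBody V) (ψ : (V →L[ℝ] ℝ) → ℝ) (y : V) :
    mixedVolFn μ K (fun ξ => ψ ξ - ξ y) = mixedVolFn μ K ψ := by
  unfold mixedVolFn
  congr 3
  ext t
  congr 1
  rw [← measure_preimage_add μ (-(t • y))]
  congr 1
  ext x
  refine forall_congr' fun ξ => ?_
  rw [map_add, map_neg, map_smul, smul_eq_mul, mul_sub]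
  constructor <;> intro h <;> linarith

end MixedVolumeUniqueness

section MixedVolumeKernel

variable {V : Type*} [NormedAddCommGroup V] [NormedSpace ℝ V] [FiniteDimensional ℝ V]

/-- The coordinate functionals of a basis, as continuous functionals. -/
def coordCLM (b : Basis (Fin 3) ℝ V) (i : Fin 3) : V →L[ℝ] ℝ :=
  (b.coord i).toContinuousLinearMap

theorem coordCLM_apply_sum (b : Basis (Fin 3) ℝ V) (a : Fin 3 → ℝ) (i : Fin 3) :
    coordCLM b i (∑ j, a j • b j) = a i := by
  change b.repr (∑ j, a j • b j) i = a i
  rw [b.repr_sum_self]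

theorem eq_sum_smul_coordCLM (b : Basis (Fin 3) ℝ V) (ξ : V →L[ℝ] ℝ) :
    ξ = ∑ i, ξ (b i) • coordCLM b i := by
  ext x
  conv_lhs => rw [← b.sum_repr x]
  rw [map_sum, _root_.sum_apply]
  refine Finset.sum_congr rfl fun i _ => ?_
  rw [map_smul, smul_eq_mul, mul_comm]
  rfl

theorem isSimplexNormals_coordCLM (b : Basis (Fin 3) ℝ V) :
    IsSimplexNormals (Fin.snoc (coordCLM b) (-∑ i, coordCLM b i) : Fin 4 → V →L[ℝ] ℝ) := by
  refine ⟨?_, fun ξ => ⟨Fin.snoc (fun i => ξ (b i)) 0, ?_⟩, fun i => ?_⟩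
  · rw [Fin.sum_univ_castSucc]
    simp only [Fin.snoc_castSucc, Fin.snoc_last, add_neg_cancel]
  · rw [Fin.sum_univ_castSucc]
    simp only [Fin.snoc_castSucc, Fin.snoc_last]
    rw [← eq_sum_smul_coordCLM b ξ]
    ext; simp
  · induction i using Fin.lastCases with
    | last =>
      refine ⟨∑ j, (1 : ℝ) • b j, fun j hj => ?_⟩
      induction j using Fin.lastCases with
      | last => exact absurd rfl hj
      | cast j => rw [Fin.snoc_castSucc, coordCLM_apply_sum b fun _ => 1]
    | cast i =>
      refine ⟨∑ j, (if j = i then -3 else 1 : ℝ) • b j, fun j hj => ?_⟩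
      induction j using Fin.lastCases with
      | last =>
        rw [Fin.snoc_last, neg_apply, _root_.sum_apply,
          Finset.sum_congr rfl fun k _ => coordCLM_apply_sum b _ k, Finset.sum_ite,
          Finset.filter_eq', Finset.filter_ne']
        norm_num
      | cast j =>
        rw [Fin.snoc_castSucc, coordCLM_apply_sum b fun j => (if j = i then -3 else 1 : ℝ),
          if_neg fun h => hj (by rw [h])]

variable [MeasurableSpace V] [BorelSpace V] {ψ : (V →L[ℝ] ℝ) → ℝ}

theorem apply_sum_coordCLM (μ : Measure V) [μ.IsAddHaarMeasure] (hc : Continuous ψ)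
    (hh : ∀ (ξ : V →L[ℝ] ℝ) (t : ℝ), 0 < t → ψ (t • ξ) = t * ψ ξ) (ho : ∀ ξ, ψ (-ξ) = -ψ ξ)
    (h : ∀ K, mixedVolFn μ K ψ = 0) (b : Basis (Fin 3) ℝ V) :
    ψ (∑ i, coordCLM b i) = ∑ i, ψ (coordCLM b i) := by
  have hV : finrank ℝ V = 3 := by simpa using finrank_eq_card_basis b
  have hn := isSimplexNormals_coordCLM b
  set s := (∑ i, ψ (coordCLM b i) - ψ (∑ i, coordCLM b i)) / 4 with hs
  set y := ∑ i, (ψ (coordCLM b i) - s) • b i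
  have hy : ∀ i, coordCLM b i y = ψ (coordCLM b i) - s := coordCLM_apply_sum b _
  have hs0 : s = 0 := by
    refine hn.eq_zero_of_mixedVolFn_eq_zero μ hV (ψ := fun ξ => ψ ξ - ξ y)
      (hc.sub (ContinuousLinearMap.apply ℝ ℝ y).continuous) (fun ξ t ht => ?_) (fun i => ?_) ?_
    · rw [hh ξ t ht, smul_apply, smul_eq_mul, mul_sub]
    · induction i using Fin.lastCases with
      | last =>
        rw [Fin.snoc_last, ho, neg_apply, _root_.sum_apply, Finset.sum_congr rfl fun k _ => hy k,
          Finset.sum_sub_distrib]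
        simp
        linarith
      | cast i => rw [Fin.snoc_castSucc, hy]; ring
    · rw [mixedVolFn_sub_apply, h]
  rw [hs] at hs0
  linarith

/-- An odd function which is annihilated by all mixed volumes is linear. -/
theorem exists_eq_apply_of_mixedVolFn_eq_zero (μ : Measure V) [μ.IsAddHaarMeasure]
    (hV : finrank ℝ V = 3) (hc : Continuous ψ)
    (hh : ∀ (ξ : V →L[ℝ] ℝ) (t : ℝ), 0 < t → ψ (t • ξ) = t * ψ ξ) (ho : ∀ ξ, ψ (-ξ) = -ψ ξ)
    (h : ∀ K, mixedVolFn μ K ψ = 0) : ∃ x : V, ∀ ξ : V →L[ℝ] ℝ, ψ ξ = ξ x := by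
  let b : Basis (Fin 3) ℝ V := finBasisOfFinrankEq ℝ V hV
  have hsmul : ∀ (a : ℝ) (ξ : V →L[ℝ] ℝ), ψ (a • ξ) = a * ψ ξ := fun a ξ => by
    rcases lt_trichotomy a 0 with ha | rfl | ha
    · have : a • ξ = -((-a) • ξ) := by ext; simp
      rw [this, ho, hh _ _ (neg_pos.2 ha)]
      ring
    · have : (0 : ℝ) • ξ = 0 := by ext; simp
      rw [this, apply_zero_of_homogeneous (V := V →L[ℝ] ℝ) (ψ := ψ) hh, zero_mul]
    · exact hh _ _ ha
  have hdense : Dense {a : Fin 3 → ℝ | ∀ i, a i ≠ 0} := by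
    convert dense_pi Set.univ fun (i : Fin 3) _ => dense_compl_singleton (0 : ℝ) using 1
    ext; simp
  have heq : (fun a : Fin 3 → ℝ => ψ (∑ i, a i • coordCLM b i)) =
      fun a => ∑ i, a i * ψ (coordCLM b i) := by
    refine Continuous.ext_on hdense (by fun_prop) (by fun_prop) fun a ha => ?_
    have hb : ∀ i, coordCLM (b.unitsSMul fun i => (Units.mk0 (a i) (ha i))⁻¹) i =
        a i • coordCLM b i := fun i => by
      ext x
      change (b.unitsSMul _).coord i x = a i * b.coord i x
      rw [Basis.coord_unitsSMul]
      simp [Units.smul_def]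
    have := apply_sum_coordCLM μ hc hh ho h (b.unitsSMul fun i => (Units.mk0 (a i) (ha i))⁻¹)
    simpa only [hb, hsmul] using this
  refine ⟨∑ i, ψ (coordCLM b i) • b i, fun ξ => ?_⟩
  conv_lhs => rw [eq_sum_smul_coordCLM b ξ]
  refine (congrFun heq fun i => ξ (b i)).trans ?_
  simp [mul_comm]

end MixedVolumeKernel

theorem mixedVolFn_zero {V : Type*} [NormedAddCommGroup V] [NormedSpace ℝ V] [MeasurableSpace V]
    (μ : Measure V) (K : ConvexBody V) : mixedVolFn μ K (fun _ => 0) = 0 := by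
  simp [mixedVolFn]

/-- Let `W` be a 2-dimensional complex vector space,
`Z : 𝒦(W) → 𝒦(W*)` a continuous, translation invariant, `SL(W,ℂ)`-contravariant
Minkowski valuation, `f 2` its McMullen component of degree `2`, and let `E ⊆ W` be a
3-dimensional real subspace of the form `E = span_ℝ {e₁, i e₁, e₂}` with `e₁, e₂`
linearly independent over `ℂ` (with a fixed Lebesgue measure `μE` on `E`). Then for each
`u ∈ W` there is a continuous, positively 1-homogeneous, odd function `φ u : E* → ℝ`,
unique up to adding a linear function, such that `f₂(K, u) = V(K, K, φ u)` for all convex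
bodies `K ⊆ E`, where `V(K, K, ·)` denotes the mixed-volume functional on continuous
positively 1-homogeneous functions on `E*`. -/
theorem degree_two_component_mixed_volume_representation
    {W : Type*} [NormedAddCommGroup W] [NormedSpace ℂ W] [FiniteDimensional ℂ W]
    (hW : Module.finrank ℂ W = 2)
    (Z : ConvexBody W → ConvexBody (W →L[ℂ] ℂ))
    (hZc : Continuous Z) (hZt : IsTranslationInvariant Z)
    (hZv : IsMinkowskiValuation Z) (hZg : IsSLContravariant Z)
    (f : ℕ → ConvexBody W → W → ℝ) (hf : McMullenProps f)
    (hsum : ∀ (K : ConvexBody W) (u : W),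
      hSupp (Z K) (fun ξ => (ξ u).re) = ∑ i ∈ Finset.range 5, f i K u)
    (e₁ e₂ : W) (he : LinearIndependent ℂ ![e₁, e₂])
    (E : Submodule ℝ W) (hE : E = Submodule.span ℝ {e₁, Complex.I • e₁, e₂})
    [MeasurableSpace ↥E] [BorelSpace ↥E] (μE : Measure ↥E) [μE.IsAddHaarMeasure] :
    ∃ φ : W → ((↥E →L[ℝ] ℝ) → ℝ),
      (∀ u : W, Continuous (φ u)) ∧
      (∀ (u : W) (ξ : ↥E →L[ℝ] ℝ) (t : ℝ), 0 < t → φ u (t • ξ) = t * φ u ξ) ∧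
      (∀ (u : W) (ξ : ↥E →L[ℝ] ℝ), φ u (-ξ) = -φ u ξ) ∧
      (∀ (K : ConvexBody W) (hK : (K : Set W) ⊆ (E : Set W)) (u : W),
        f 2 K u = mixedVolFn μE (bodyIn E K hK) (φ u)) ∧
      (∀ ψ : W → ((↥E →L[ℝ] ℝ) → ℝ),
        ((∀ u : W, Continuous (ψ u)) ∧
         (∀ (u : W) (ξ : ↥E →L[ℝ] ℝ) (t : ℝ), 0 < t → ψ u (t • ξ) = t * ψ u ξ) ∧
         (∀ (u : W) (ξ : ↥E →L[ℝ] ℝ), ψ u (-ξ) = -ψ u ξ) ∧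
         (∀ (K : ConvexBody W) (hK : (K : Set W) ⊆ (E : Set W)) (u : W),
           f 2 K u = mixedVolFn μE (bodyIn E K hK) (ψ u))) →
        ∀ u : W, ∃ x : ↥E, ∀ ξ : ↥E →L[ℝ] ℝ, ψ u ξ = φ u ξ + ξ x) := by
  have : FiniteDimensional ℝ W := FiniteDimensional.complexToReal W
  let b : Basis (Fin 2) ℂ W := basisOfLinearIndependentOfCardEqFinrank he (by simp [hW])
  have hbE : E = Submodule.span ℝ {b 0, Complex.I • b 0, b 1} := by simp [b, hE]
  have h0 : ∀ (K : ConvexBody W), (K : Set W) ⊆ (E : Set W) → ∀ u, f 2 K u = 0 := fun K hK =>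
    component_two_eq_zero hZg hf hsum b K (hbE ▸ hK)
  have hE3 : finrank ℝ E = 3 := by rw [hbE, finrank_span_triple]
  refine ⟨fun _ _ => 0, fun _ => continuous_const, by simp, by simp, fun K hK u => ?_, ?_⟩
  · rw [mixedVolFn_zero, h0 K hK]
  · rintro ψ ⟨hc, hh, ho, hψ⟩ u
    obtain ⟨x, hx⟩ := exists_eq_apply_of_mixedVolFn_eq_zero μE hE3 (hc u) (hh u) (ho u)
      fun K => by
        have hK : (K.mapCLM E.subtypeL : Set W) ⊆ (E : Set W) := by
          rintro _ ⟨y, -, rfl⟩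
          exact y.2
        have hbody : bodyIn E (K.mapCLM E.subtypeL) hK = K :=
          SetLike.coe_injective (Set.preimage_image_eq (K : Set E) Subtype.val_injective)
        rw [← hbody, ← hψ _ hK u, h0 _ hK]
    exact ⟨x, fun ξ => by rw [hx ξ, zero_add]⟩
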